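/- arXiv:1107.2314 — 3 statements merged into one kernel-verified Lean document; each statement's English description precedes it below -/
import Mathlib

section
/- Let X and Y be disjoint finite sets of n 'red' and n 'blue' points respectively, with X ∪ Y in general position in the plane. Then there exists a non-crossing perfect matching of X ∪ Y in which every segment joins one red point to one blue point, i.e., a partition of X ∪ Y into n pairs, each pair consisting of one point of X and one point of Y, such that the closed segments joining the pairs are pairwise disjoint. -/
open MeasureTheory Set Filter

noncomputable section

abbrev Pt : Type := ℝ × ℝ

/-- A finite point set is in general position: no three distinct points are collinear. -/
def GenPos (X : Finset Pt) : Prop :=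
  ∀ a ∈ X, ∀ b ∈ X, ∀ c ∈ X, a ≠ b → a ≠ c → b ≠ c → ¬ Collinear ℝ ({a, b, c} : Set Pt)

/-- `e` is an edge of `X`: an unordered pair of distinct points of `X`. -/
def IsEdgeOf (X : Finset Pt) (e : Sym2 Pt) : Prop :=
  ¬ e.IsDiag ∧ ∀ p ∈ e, p ∈ X

/-- The closed segment joining the two points of an unordered pair. -/
def edgeSeg (e : Sym2 Pt) : Set Pt :=
  Sym2.lift ⟨fun u v => segment ℝ u v, fun u v => segment_symm ℝ u v⟩ e

/-- `M` is a non-crossing perfect matching of `X`: a partition of `X` into unordered pairs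
whose closed segments are pairwise disjoint. -/
def IsNCMatching (X : Finset Pt) (M : Finset (Sym2 Pt)) : Prop :=
  (∀ e ∈ M, IsEdgeOf X e) ∧
  (∀ p ∈ X, ∃! e, e ∈ M ∧ p ∈ e) ∧
  (M : Set (Sym2 Pt)).Pairwise fun e f => Disjoint (edgeSeg e) (edgeSeg f)

/-- The matching `M` avoids the edge set `S`. -/
def Avoids (M S : Finset (Sym2 Pt)) : Prop := ∀ e ∈ M, e ∉ S

/-- If two segments meet at `p` and exchanging their right endpoints does not decrease the total
length, then `p` also lies on an exchanged segment. -/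
theorem wbtw_of_dist_add_dist_le {E : Type*} [NormedAddCommGroup E] [NormedSpace ℝ E]
    [StrictConvexSpace ℝ E] {x₁ y₁ x₂ y₂ p : E} (h₁ : Wbtw ℝ x₁ p y₁) (h₂ : Wbtw ℝ x₂ p y₂)
    (h : dist x₁ y₁ + dist x₂ y₂ ≤ dist x₁ y₂ + dist x₂ y₁) : Wbtw ℝ x₁ p y₂ := by
  rw [← dist_add_dist_eq_iff] at *
  linarith [dist_triangle x₁ p y₂, dist_triangle x₂ p y₁]

/-- Two points whose segments from `x` share a point other than `x` are collinear with `x`. -/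
theorem collinear_of_wbtw_of_wbtw {E : Type*} [AddCommGroup E] [Module ℝ E] {x y z p : E}
    (hp : x ≠ p) (hy : Wbtw ℝ x p y) (hz : Wbtw ℝ x p z) : Collinear ℝ ({x, y, z} : Set E) := by
  refine (collinear_insert_insert_of_mem_affineSpan_pair
    (hy.right_mem_affineSpan_of_left_ne hp) (hz.right_mem_affineSpan_of_left_ne hp)).subset ?_
  intro q hq
  simp only [Set.mem_insert_iff, Set.mem_singleton_iff] at hq ⊢
  tauto

/-- The Euclidean distance between two points of the plane. -/
def euclDist (p q : Pt) : ℝ := dist (WithLp.toLp 2 p) (WithLp.toLp 2 q)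

theorem wbtw_of_euclDist_le {x₁ y₁ x₂ y₂ p : Pt} (h₁ : Wbtw ℝ x₁ p y₁) (h₂ : Wbtw ℝ x₂ p y₂)
    (h : euclDist x₁ y₁ + euclDist x₂ y₂ ≤ euclDist x₁ y₂ + euclDist x₂ y₁) :
    Wbtw ℝ x₁ p y₂ := by
  let f := (WithLp.linearEquiv 2 ℝ Pt).symm.toAffineEquiv
  have key := wbtw_of_dist_add_dist_le (f.wbtw_map_iff.2 h₁) (f.wbtw_map_iff.2 h₂) h
  exact f.wbtw_map_iff.1 key

/-- Segments with four distinct endpoints in general position are disjoint if exchanging their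
right endpoints does not decrease the total length. -/
theorem GenPos.disjoint_segment {Z : Finset Pt} (hZ : GenPos Z) {x₁ y₁ x₂ y₂ : Pt}
    (hx₁ : x₁ ∈ Z) (hy₁ : y₁ ∈ Z) (hx₂ : x₂ ∈ Z) (hy₂ : y₂ ∈ Z) (hxx : x₁ ≠ x₂) (hyy : y₁ ≠ y₂)
    (h₁₁ : x₁ ≠ y₁) (h₁₂ : x₁ ≠ y₂) (h₂₂ : x₂ ≠ y₂)
    (h : euclDist x₁ y₁ + euclDist x₂ y₂ ≤ euclDist x₁ y₂ + euclDist x₂ y₁) :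
    Disjoint (segment ℝ x₁ y₁) (segment ℝ x₂ y₂) := by
  rw [Set.disjoint_left]
  intro p hp₁ hp₂
  rw [mem_segment_iff_wbtw] at hp₁ hp₂
  by_cases hp : x₁ = p
  · subst hp
    exact hZ x₂ hx₂ x₁ hx₁ y₂ hy₂ hxx.symm h₂₂ h₁₂ hp₂.collinear
  · exact hZ x₁ hx₁ y₁ hy₁ y₂ hy₂ h₁₁ h₁₂ hyy
      (collinear_of_wbtw_of_wbtw hp hp₁ (wbtw_of_euclDist_le hp₁ hp₂ h))

/-- In an assignment of minimal total cost no exchange of two values decreases the cost. -/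
theorem add_le_add_of_forall_sum_le {α β : Type*} [Fintype α] [DecidableEq α] (c : α → β → ℝ)
    (e : α ≃ β) (he : ∀ f : α ≃ β, ∑ a, c a (e a) ≤ ∑ a, c a (f a)) {a b : α} (hab : a ≠ b) :
    c a (e a) + c b (e b) ≤ c a (e b) + c b (e a) := by
  have h := he ((Equiv.swap a b).trans e)
  rw [← Finset.sum_add_sum_compl {a, b}, ← Finset.sum_add_sum_compl {a, b} (fun i => c i _),
    Finset.sum_pair hab, Finset.sum_pair hab] at h
  have hrest : ∑ i ∈ ({a, b} : Finset α)ᶜ, c i (((Equiv.swap a b).trans e) i) =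
      ∑ i ∈ ({a, b} : Finset α)ᶜ, c i (e i) := by
    refine Finset.sum_congr rfl fun i hi => ?_
    simp only [Finset.mem_compl, Finset.mem_insert, Finset.mem_singleton, not_or] at hi
    rw [Equiv.trans_apply, Equiv.swap_apply_of_ne_of_ne hi.1 hi.2]
  rw [hrest] at h
  simpa using h

/-- Ham-Sandwich corollary: for disjoint sets of `n` red and `n` blue points
in general position there is a non-crossing perfect matching each of whose segments joins a
red point to a blue point. -/
theorem red_blue_noncrossing_matching (n : ℕ) (X Y : Finset Pt)
    (hdisj : Disjoint X Y) (hXcard : X.card = n) (hYcard : Y.card = n)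
    (hgp : GenPos (X ∪ Y)) :
    ∃ M : Finset (Sym2 Pt), IsNCMatching (X ∪ Y) M ∧
      ∀ e ∈ M, ∃ x ∈ X, ∃ y ∈ Y, e = s(x, y) := by
  classical
  have hne : Nonempty (X ≃ Y) :=
    ⟨Fintype.equivOfCardEq (by simp [hXcard, hYcard])⟩
  obtain ⟨e, he⟩ := Finite.exists_min fun f : X ≃ Y => ∑ x : X, euclDist x (f x)
  have hX (x : X) : (x : Pt) ∈ X ∪ Y := Finset.mem_union_left _ x.2
  have hY (y : Y) : (y : Pt) ∈ X ∪ Y := Finset.mem_union_right _ y.2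
  have hXY (x : X) (y : Y) : (x : Pt) ≠ y := Finset.disjoint_iff_ne.1 hdisj x x.2 y y.2
  refine ⟨Finset.univ.image fun x : X => s((x : Pt), (e x : Pt)), ⟨?_, ?_, ?_⟩, ?_⟩
  · simp only [Finset.mem_image, Finset.mem_univ, true_and, forall_exists_index,
      forall_apply_eq_imp_iff]
    intro x
    refine ⟨by simpa using hXY x (e x), fun p hp => ?_⟩
    rcases Sym2.mem_iff.1 hp with rfl | rfl
    exacts [hX x, hY _]
  · have hmatch (x : X) (p : Pt) (hp : p ∈ s((x : Pt), (e x : Pt)))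
        (huniq : ∀ z : X, p ∈ s((z : Pt), (e z : Pt)) → z = x) :
        ∃! d, d ∈ Finset.univ.image (fun x : X => s((x : Pt), (e x : Pt))) ∧ p ∈ d := by
      refine ⟨_, ⟨Finset.mem_image_of_mem _ (Finset.mem_univ x), hp⟩, ?_⟩
      rintro d ⟨hd, hpd⟩
      obtain ⟨z, -, rfl⟩ := Finset.mem_image.1 hd
      rw [huniq z hpd]
    intro p hp
    rcases Finset.mem_union.1 hp with hp | hp
    · refine hmatch ⟨p, hp⟩ p (Sym2.mem_mk_left _ _) fun z hz => ?_
      rcases Sym2.mem_iff.1 hz with h | h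
      · exact Subtype.ext h.symm
      · exact absurd h (hXY ⟨p, hp⟩ (e z))
    · refine hmatch (e.symm ⟨p, hp⟩) p (by simp) fun z hz => ?_
      rcases Sym2.mem_iff.1 hz with h | h
      · exact absurd h.symm (hXY z ⟨p, hp⟩)
      · exact (e.eq_symm_apply).2 (Subtype.ext h.symm)
  · intro d hd d' hd' hdd'
    obtain ⟨a, -, rfl⟩ := Finset.mem_image.1 hd
    obtain ⟨b, -, rfl⟩ := Finset.mem_image.1 hd'
    have hab : a ≠ b := by
      rintro rfl
      exact hdd' rfl
    exact hgp.disjoint_segment (hX a) (hY _) (hX b) (hY _) (Subtype.coe_injective.ne hab)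
      (Subtype.coe_injective.ne (e.injective.ne hab)) (hXY _ _) (hXY _ _) (hXY _ _)
      (add_le_add_of_forall_sum_le (fun (x : X) (y : Y) => euclDist x y) e he hab)
  · intro d hd
    obtain ⟨x, -, rfl⟩ := Finset.mem_image.1 hd
    exact ⟨x, x.2, e x, (e x).2, rfl⟩
end
end

section
/- Let X be a set of 2n points in the plane in convex position (every point of X is an extreme point of the convex hull of X), n ≥ 1, and in general position. Then there exists a set S of exactly n edges of X such that no non-crossing perfect matching of X avoids S. (Hence the bound n−1 in the edge-removal theorem for general point sets is tight.) -/
open MeasureTheory Set Filter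

noncomputable section

/-- Twice the signed area of the triangle `a b c`. -/
def orientDet (a b c : Pt) : ℝ :=
  (b.1 - a.1) * (c.2 - a.2) - (b.2 - a.2) * (c.1 - a.1)

lemma collinear_of_orientDet_eq_zero {a b c : Pt} (hab : a ≠ b) (h : orientDet a b c = 0) :
    Collinear ℝ ({a, b, c} : Set Pt) := by
  rw [collinear_iff_of_mem (p₀ := a) (by simp)]
  refine ⟨b - a, ?_⟩
  unfold orientDet at h
  have key : ∃ r : ℝ, c = r • (b - a) + a := by
    by_cases h1 : b.1 - a.1 = 0
    · have h2 : b.2 - a.2 ≠ 0 := fun h2 => hab (Prod.ext (by linarith) (by linarith))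
      refine ⟨(c.2 - a.2) / (b.2 - a.2), Prod.ext ?_ ?_⟩
      · have : c.1 - a.1 = 0 := by
          rw [h1] at h
          simpa [h2] using h
        simp [h1]
        linarith
      · simp
        field_simp
        ring
    · refine ⟨(c.1 - a.1) / (b.1 - a.1), Prod.ext ?_ ?_⟩
      · simp
        field_simp
        ring
      · simp
        field_simp
        linarith
  rintro x (rfl | rfl | rfl)
  · exact ⟨0, by simp⟩
  · exact ⟨1, by simp⟩
  · simpa using key

/-- A point strictly inside the triangle of three points of a set is not extreme in its
convex hull. -/
lemma not_extreme_of_orientDet_pos {X : Set Pt} {x a b c : Pt} (ha : a ∈ X) (hb : b ∈ X)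
    (hc : c ∈ X) (hab : 0 < orientDet x a b) (hbc : 0 < orientDet x b c)
    (hca : 0 < orientDet x c a) : x ∉ extremePoints ℝ (convexHull ℝ X) := by
  intro hx
  have hxX : x ∈ X := extremePoints_convexHull_subset hx
  rw [(convex_convexHull ℝ X).mem_extremePoints_iff_mem_sdiff_convexHull_sdiff] at hx
  have hne : ∀ y ∈ X, y ≠ x → y ∈ convexHull ℝ (convexHull ℝ X \ {x}) := fun y hy hyx =>
    subset_convexHull ℝ _ ⟨subset_convexHull ℝ _ hy, hyx⟩
  have hax : a ≠ x := by rintro rfl; simp [orientDet] at hab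
  have hbx : b ≠ x := by rintro rfl; simp [orientDet] at hab
  have hcx : c ≠ x := by rintro rfl; simp [orientDet] at hca
  apply hx.2
  have hT : 0 < orientDet x b c + orientDet x c a + orientDet x a b := by positivity
  have := (convex_convexHull ℝ (convexHull ℝ X \ {x})).sum_mem (t := Finset.univ)
    (w := ![orientDet x b c / (orientDet x b c + orientDet x c a + orientDet x a b),
      orientDet x c a / (orientDet x b c + orientDet x c a + orientDet x a b),
      orientDet x a b / (orientDet x b c + orientDet x c a + orientDet x a b)])
    (z := ![a, b, c])
    (by intro i _; fin_cases i <;> simp <;> positivity)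
    (by simp [Fin.sum_univ_three]; field_simp)
    (by
      intro i _
      fin_cases i
      exacts [hne a ha hax, hne b hb hbx, hne c hc hcx])
  convert this using 1
  simp only [Fin.sum_univ_three, Matrix.cons_val]
  apply Prod.ext <;> simp <;> field_simp <;> unfold orientDet <;> ring

/-- The diagonals of a convex quadrilateral meet. -/
lemma not_disjoint_segment_of_orientDet_pos {a b c d : Pt} (habc : 0 < orientDet a b c)
    (habd : 0 < orientDet a b d) (hacd : 0 < orientDet a c d) (hbcd : 0 < orientDet b c d) :
    ¬ Disjoint (segment ℝ a c) (segment ℝ b d) := by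
  rw [Set.not_disjoint_iff]
  have hT : orientDet a c d + orientDet a b c = orientDet b c d + orientDet a b d := by
    unfold orientDet
    ring
  have h1 : 0 < orientDet a c d + orientDet a b c := by positivity
  have h2 : 0 < orientDet b c d + orientDet a b d := by positivity
  refine ⟨(orientDet b c d / (orientDet b c d + orientDet a b d)) • a +
      (orientDet a b d / (orientDet b c d + orientDet a b d)) • c,
    ⟨_, _, by positivity, by positivity, by field_simp, rfl⟩,
    ⟨orientDet a c d / (orientDet a c d + orientDet a b c),
      orientDet a b c / (orientDet a c d + orientDet a b c),
      by positivity, by positivity, by field_simp, ?_⟩⟩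
  rw [hT]
  apply Prod.ext <;> simp <;> field_simp <;> unfold orientDet <;> ring

lemma orientDet_rotate (a b c : Pt) : orientDet b c a = orientDet a b c := by
  unfold orientDet
  ring

lemma orientDet_swap (a b c : Pt) : orientDet a c b = -orientDet a b c := by
  unfold orientDet
  ring

lemma exists_equiv_fin_of_isStrictTotalOrder {α : Type*} [Fintype α] (r : α → α → Prop)
    [IsStrictTotalOrder α r] {k : ℕ} (hk : Fintype.card α = k) :
    ∃ e : Fin k ≃ α, ∀ i j, i < j → r (e i) (e j) := by
  classical
  let _ : LinearOrder α := linearOrderOfSTO r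
  let e := Fintype.orderIsoFinOfCardEq α hk
  exact ⟨e.toEquiv, fun i j h => e.strictMono h⟩

/-- Points in convex and general position can be listed in counterclockwise order. -/
lemma exists_counterclockwise_enumeration {X : Finset Pt} (hgp : GenPos X)
    (hconv : ∀ p ∈ X, p ∈ Set.extremePoints ℝ (convexHull ℝ (X : Set Pt)))
    (hne : X.Nonempty) :
    ∃ f : Fin X.card ≃ X, ∀ i j k, i < j → j < k → 0 < orientDet (f i) (f j) (f k) := by
  obtain ⟨p, hp⟩ := hne
  have hinside : ∀ x ∈ X, ∀ a ∈ X, ∀ b ∈ X, ∀ c ∈ X, 0 < orientDet x a b →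
      0 < orientDet x b c → ¬ 0 < orientDet x c a := fun x hx a ha b hb c hc h1 h2 h3 =>
    not_extreme_of_orientDet_pos ha hb hc h1 h2 h3 (hconv x hx)
  have hnz : ∀ a ∈ X, ∀ b ∈ X, ∀ c ∈ X, a ≠ b → a ≠ c → b ≠ c → orientDet a b c ≠ 0 :=
    fun a ha b hb c hc hab hac hbc h =>
      hgp a ha b hb c hc hab hac hbc (collinear_of_orientDet_eq_zero hab h)
  have hself : ∀ a : Pt, orientDet p a a = 0 := fun a => by unfold orientDet; ring
  let r : X → X → Prop := fun a b =>
    (a.1 = p ∧ b.1 ≠ p) ∨ (a.1 ≠ p ∧ b.1 ≠ p ∧ 0 < orientDet p a b)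
  have htrans : ∀ a b c : X, r a b → r b c → r a c := by
    rintro a b c (⟨ha, hb⟩ | ⟨ha, hb, hab⟩) (⟨hb', hc⟩ | ⟨hb', hc, hbc⟩)
    · exact absurd hb' hb
    · exact Or.inl ⟨ha, hc⟩
    · exact absurd hb' hb
    · refine Or.inr ⟨ha, hc, ?_⟩
      have hac : a.1 ≠ c.1 := by
        intro h
        rw [← h, orientDet_swap] at hbc
        linarith
      have h0 := hnz p hp a a.2 c c.2 ha.symm hc.symm hac
      have h1 := hinside p hp a a.2 b b.2 c c.2 hab hbc
      rw [orientDet_swap] at h1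
      rcases lt_or_gt_of_ne h0 with h | h
      · exact absurd (by linarith) h1
      · exact h
  have hirr : ∀ a : X, ¬ r a a := by
    rintro a (⟨ha, ha'⟩ | ⟨-, -, h⟩)
    · exact ha' ha
    · exact absurd (hself a) h.ne'
  have htri : ∀ a b : X, ¬ r a b → ¬ r b a → a = b := by
    intro a b hab hba
    by_contra hne
    have hne' : a.1 ≠ b.1 := fun h => hne (Subtype.ext h)
    by_cases ha : a.1 = p
    · exact hab (Or.inl ⟨ha, fun h => hne' (ha.trans h.symm)⟩)
    by_cases hb : b.1 = p
    · exact hba (Or.inl ⟨hb, ha⟩)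
    rcases lt_or_gt_of_ne (hnz p hp a a.2 b b.2 (Ne.symm ha) (Ne.symm hb) hne') with h | h
    · exact hba (Or.inr ⟨hb, ha, by rw [orientDet_swap]; linarith⟩)
    · exact hab (Or.inr ⟨ha, hb, h⟩)
  have hpos : ∀ a b c : X, r a b → r b c → 0 < orientDet a b c := by
    intro a b c hab hbc
    have hac := htrans a b c hab hbc
    rcases hab with ⟨ha, hb⟩ | ⟨ha, hb, hab⟩ <;> rcases hbc with ⟨hb', hc⟩ | ⟨hb', hc, hbc⟩
    · exact absurd hb' hb
    · rwa [ha]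
    · exact absurd hb' hb
    · rcases hac with ⟨ha', -⟩ | ⟨-, -, hac⟩
      · exact absurd ha' ha
      have h1 : a.1 ≠ b.1 := fun h => by rw [h, hself] at hab; exact lt_irrefl _ hab
      have h2 : b.1 ≠ c.1 := fun h => by rw [h, hself] at hbc; exact lt_irrefl _ hbc
      have h3 : a.1 ≠ c.1 := fun h => by rw [h, hself] at hac; exact lt_irrefl _ hac
      rcases lt_or_gt_of_ne (hnz a a.2 b b.2 c c.2 h1 h3 h2) with h | h
      · refine absurd ?_ (hinside b b.2 c c.2 p hp a a.2 ?_ ?_)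
        · have := orientDet_rotate a b c
          rw [orientDet_swap, this]
          linarith
        · rwa [orientDet_rotate]
        · rwa [← orientDet_rotate, ← orientDet_rotate] at hab
      · exact h
  have : IsStrictTotalOrder X r :=
    { irrefl := hirr
      trans := htrans
      trichotomous := htri }
  obtain ⟨e, he⟩ := exists_equiv_fin_of_isStrictTotalOrder r (Fintype.card_coe X)
  exact ⟨e, fun i j k hij hjk => hpos _ _ _ (he i j hij) (he j k hjk)⟩

lemma IsNCMatching.eq_of_mem {X : Finset Pt} {M : Finset (Sym2 Pt)} (hM : IsNCMatching X M)
    {e f : Sym2 Pt} {p : Pt} (he : e ∈ M) (hf : f ∈ M) (hpe : p ∈ e) (hpf : p ∈ f) : e = f :=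
  (hM.2.1 p ((hM.1 e he).2 p hpe)).unique ⟨he, hpe⟩ ⟨hf, hpf⟩

lemma IsNCMatching.right_unique {X : Finset Pt} {M : Finset (Sym2 Pt)} (hM : IsNCMatching X M)
    {p q q' : Pt} (h : s(p, q) ∈ M) (h' : s(p, q') ∈ M) : q = q' :=
  Sym2.congr_right.1 (hM.eq_of_mem h h' (Sym2.mem_mk_left _ _) (Sym2.mem_mk_left _ _))

lemma IsNCMatching.exists_partner {X : Finset Pt} {M : Finset (Sym2 Pt)}
    (hM : IsNCMatching X M) {p : Pt} (hp : p ∈ X) : ∃ q ∈ X, q ≠ p ∧ s(p, q) ∈ M := by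
  obtain ⟨e, ⟨he, hpe⟩, -⟩ := hM.2.1 p hp
  obtain ⟨q, rfl⟩ := hpe
  obtain ⟨hd, hX⟩ := hM.1 _ he
  exact ⟨q, hX q (Sym2.mem_mk_right _ _), fun h => hd (by simp [h]), he⟩

lemma IsNCMatching.not_crossing {X : Finset Pt} {M : Finset (Sym2 Pt)} (hM : IsNCMatching X M)
    {a b c d : Pt} (hac : s(a, c) ∈ M) (hbd : s(b, d) ∈ M) (habc : 0 < orientDet a b c)
    (habd : 0 < orientDet a b d) (hacd : 0 < orientDet a c d)
    (hbcd : 0 < orientDet b c d) : False := by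
  refine not_disjoint_segment_of_orientDet_pos habc habd hacd hbcd (hM.2.2 hac hbd fun h => ?_)
  rcases Sym2.eq_iff.1 h with ⟨rfl, -⟩ | ⟨rfl, -⟩
  · simp [orientDet] at habc
  · simp [orientDet] at habd

/-- for `2n` points in convex position there is a set of exactly `n` edges
whose removal eliminates every non-crossing perfect matching. -/
theorem convex_position_n_edges_eliminate (n : ℕ) (hn : 1 ≤ n) (X : Finset Pt)
    (hXcard : X.card = 2 * n) (hgp : GenPos X)
    (hconv : ∀ p ∈ X, p ∈ Set.extremePoints ℝ (convexHull ℝ (X : Set Pt))) :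
    ∃ S : Finset (Sym2 Pt), S.card = n ∧ (∀ e ∈ S, IsEdgeOf X e) ∧
      ∀ M : Finset (Sym2 Pt), IsNCMatching X M → ¬ Avoids M S := by
  obtain ⟨f, hf⟩ := exists_counterclockwise_enumeration hgp hconv
    (Finset.card_pos.1 (by omega))
  let v : ℕ → Pt := fun i => if h : i < X.card then f ⟨i, h⟩ else 0
  have hv : ∀ i (h : i < 2 * n), v i = f ⟨i, by omega⟩ := fun i h =>
    dif_pos (by omega : i < X.card)
  have hvX : ∀ i < 2 * n, v i ∈ X := fun i h => by rw [hv i h]; exact (f _).2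
  have hinj : ∀ i < 2 * n, ∀ j < 2 * n, v i = v j → i = j := by
    intro i hi j hj h
    rw [hv i hi, hv j hj] at h
    simpa using f.injective (Subtype.ext h)
  have hsurj : ∀ x ∈ X, ∃ i < 2 * n, v i = x := by
    intro x hx
    obtain ⟨i, hi⟩ := f.surjective ⟨x, hx⟩
    have hi' : i.1 < 2 * n := by omega
    exact ⟨i, hi', by rw [hv i hi']; exact congrArg Subtype.val hi⟩
  have hpos : ∀ i j k, i < j → j < k → k < 2 * n → 0 < orientDet (v i) (v j) (v k) := by
    intro i j k hij hjk hk
    rw [hv i (by omega), hv j (by omega), hv k hk]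
    exact hf _ _ _ hij hjk
  refine ⟨(Finset.range n).image fun i => s(v i, v (i + 1)), ?_, ?_, ?_⟩
  · rw [Finset.card_image_of_injOn, Finset.card_range]
    intro i hi j hj h
    simp only [Finset.coe_range, Set.mem_Iio] at hi hj
    rcases Sym2.eq_iff.1 h with ⟨h1, -⟩ | ⟨h1, h2⟩
    · exact hinj i (by omega) j (by omega) h1
    · have := hinj i (by omega) (j + 1) (by omega) h1
      have := hinj (i + 1) (by omega) j (by omega) h2
      omega
  · intro e he
    obtain ⟨i, hi, rfl⟩ := Finset.mem_image.1 he
    rw [Finset.mem_range] at hi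
    refine ⟨fun h => ?_, fun p hp => ?_⟩
    · have := hinj i (by omega) (i + 1) (by omega) (Sym2.mk_isDiag_iff.1 h)
      omega
    · rcases Sym2.mem_iff.1 hp with rfl | rfl
      · exact hvX _ (by omega)
      · exact hvX _ (by omega)
  · intro M hM hav
    have hpartner : ∀ i < 2 * n, ∃ m < 2 * n, m ≠ i ∧ s(v i, v m) ∈ M := by
      intro i hi
      obtain ⟨q, hq, hqi, hqM⟩ := hM.exists_partner (hvX i hi)
      obtain ⟨m, hm, rfl⟩ := hsurj q hq
      exact ⟨m, hm, fun h => hqi (by rw [h]), hqM⟩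
    have hfree : ∀ d i j, j - i ≤ d → i < j → j ≤ n → s(v i, v j) ∉ M := by
      intro d
      induction d with
      | zero => intro i j h1 h2; omega
      | succ d ih =>
        intro i j hd hij hj hmem
        by_cases hj1 : j = i + 1
        · subst hj1
          exact hav _ hmem (Finset.mem_image.2 ⟨i, Finset.mem_range.2 (by omega), rfl⟩)
        obtain ⟨m, hm, hmi, hmM⟩ := hpartner (i + 1) (by omega)
        have hmM' : s(v m, v (i + 1)) ∈ M := by rwa [Sym2.eq_swap]
        have hmem' : s(v j, v i) ∈ M := by rwa [Sym2.eq_swap]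
        rcases lt_trichotomy m i with h | rfl | h
        · exact hM.not_crossing hmM' hmem (hpos _ _ _ h (by omega) (by omega))
            (hpos _ _ _ h hij (by omega)) (hpos _ _ _ (by omega) (by omega) (by omega))
            (hpos _ _ _ (by omega) (by omega) (by omega))
        · have := hinj _ (by omega) _ (by omega) (hM.right_unique hmem hmM')
          omega
        rcases lt_trichotomy m j with h' | rfl | h'
        · exact ih (i + 1) m (by omega) (by omega) (by omega) hmM
        · have := hinj _ (by omega) _ (by omega) (hM.right_unique hmem' hmM')
          omega
        · exact hM.not_crossing hmem hmM (hpos _ _ _ (by omega) (by omega) (by omega))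
            (hpos _ _ _ (by omega) (by omega) hm) (hpos _ _ _ hij h' hm)
            (hpos _ _ _ (by omega) h' hm)
    choose! g hg hgi hgM using hpartner
    have hmaps : Set.MapsTo g (Finset.range (n + 1)) (Finset.Ico (n + 1) (2 * n)) := by
      intro i hi
      simp only [Finset.coe_range, Set.mem_Iio] at hi
      have hi' : i < 2 * n := by omega
      simp only [Finset.coe_Ico, Set.mem_Ico]
      refine ⟨?_, hg i hi'⟩
      by_contra hlt
      have hM1 := hgM i hi'
      rcases lt_or_gt_of_ne (hgi i hi') with h | h
      · rw [Sym2.eq_swap] at hM1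
        exact hfree _ _ _ le_rfl h (by omega) hM1
      · exact hfree _ _ _ le_rfl h (by omega) hM1
    have hginj : Set.InjOn g (Finset.range (n + 1)) := by
      intro i hi j hj h
      simp only [Finset.coe_range, Set.mem_Iio] at hi hj
      have h1 := hgM i (by omega)
      have h2 := hgM j (by omega)
      rw [Sym2.eq_swap] at h1 h2
      rw [← h] at h2
      exact hinj i (by omega) j (by omega) (hM.right_unique h1 h2)
    have := Finset.card_le_card_of_injOn g hmaps hginj
    rw [Finset.card_range, Nat.card_Ico] at this
    omega
end
end

section
/- Let X be a set of 2n points in general position in the plane and let H be a set of exactly n edges of X such that no non-crossing perfect matching of X avoids H. Then every point of X that is an endpoint of at least two edges of H is an extreme point of the convex hull of X. -/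
open MeasureTheory Set Filter

noncomputable section

/-- Some non-crossing perfect matching of `X` avoids `H`. -/
def HasAvoidingMatching (X : Finset Pt) (H : Finset (Sym2 Pt)) : Prop :=
  ∃ M : Finset (Sym2 Pt), IsNCMatching X M ∧ Avoids M H

/-- The signed area of the parallelogram spanned by `b - a` and `z - a`. -/
def cross (a b z : Pt) : ℝ := (b.1 - a.1) * (z.2 - a.2) - (b.2 - a.2) * (z.1 - a.1)

lemma cross_combo (x y u v : Pt) {a b : ℝ} (h : a + b = 1) :
    cross x y (a • u + b • v) = a * cross x y u + b * cross x y v := by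
  obtain rfl : b = 1 - a := by linarith
  simp only [cross, Prod.fst_add, Prod.snd_add, Prod.smul_fst, Prod.smul_snd, smul_eq_mul]
  ring

@[simp] lemma cross_left (x y : Pt) : cross x y x = 0 := by simp [cross]

@[simp] lemma cross_right (x y : Pt) : cross x y y = 0 := by simp only [cross]; ring

lemma cross_swap (x y z : Pt) : cross y x z = -cross x y z := by simp only [cross]; ring

lemma collinear_of_cross_eq_zero {a b z : Pt} (hab : a ≠ b) (h : cross a b z = 0) :
    Collinear ℝ ({a, b, z} : Set Pt) := by
  rw [collinear_iff_of_mem (p₀ := a) (by simp)]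
  refine ⟨b - a, ?_⟩
  have hD : 0 < (b.1 - a.1) ^ 2 + (b.2 - a.2) ^ 2 := by
    by_contra hc
    have h1 : b.1 - a.1 = 0 := by nlinarith [sq_nonneg (b.1 - a.1), sq_nonneg (b.2 - a.2)]
    have h2 : b.2 - a.2 = 0 := by nlinarith [sq_nonneg (b.1 - a.1), sq_nonneg (b.2 - a.2)]
    exact hab (Prod.ext (by linarith) (by linarith))
  rintro p (rfl | rfl | rfl)
  · exact ⟨0, by simp⟩
  · exact ⟨1, by simp⟩
  · refine ⟨((b.1 - a.1) * (p.1 - a.1) + (b.2 - a.2) * (p.2 - a.2)) /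
      ((b.1 - a.1) ^ 2 + (b.2 - a.2) ^ 2), ?_⟩
    simp only [cross] at h
    ext
    · simp only [vadd_eq_add, Prod.fst_add, Prod.smul_fst, Prod.fst_sub, smul_eq_mul]
      field_simp
      linear_combination -(b.2 - a.2) * h
    · simp only [vadd_eq_add, Prod.snd_add, Prod.smul_snd, Prod.snd_sub, smul_eq_mul]
      field_simp
      linear_combination (b.1 - a.1) * h

lemma GenPos.cross_ne_zero {X : Finset Pt} (hX : GenPos X) {a b z : Pt} (ha : a ∈ X) (hb : b ∈ X)
    (hz : z ∈ X) (hab : a ≠ b) (hza : z ≠ a) (hzb : z ≠ b) : cross a b z ≠ 0 := fun h =>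
  hX a ha b hb z hz hab hza.symm hzb.symm (collinear_of_cross_eq_zero hab h)

lemma GenPos.mono {X Y : Finset Pt} (hX : GenPos X) (h : Y ⊆ X) : GenPos Y :=
  fun a ha b hb c hc => hX a (h ha) b (h hb) c (h hc)

lemma convex_lt_cross (x y : Pt) (t : ℝ) : Convex ℝ {z | t < cross x y z} := by
  intro u hu v hv a b ha hb hab
  simp only [mem_ofPred_eq] at *
  rw [cross_combo x y u v hab]
  obtain rfl : b = 1 - a := by linarith
  rcases ha.eq_or_lt with rfl | ha
  · simpa using hv
  · nlinarith [mul_pos ha (sub_pos.2 hu), mul_nonneg hb (sub_pos.2 hv).le]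

lemma convex_cross_pos (x y : Pt) : Convex ℝ {z | 0 < cross x y z} :=
  convex_lt_cross x y 0

lemma convex_cross_nonneg (x y : Pt) : Convex ℝ {z | 0 ≤ cross x y z} := by
  intro u hu v hv a b ha hb hab
  simp only [mem_ofPred_eq] at *
  rw [cross_combo x y u v hab]
  positivity

lemma convex_cross_eq_zero (x y : Pt) : Convex ℝ {z | cross x y z = 0} := by
  intro u hu v hv a b ha hb hab
  simp only [mem_ofPred_eq] at *
  rw [cross_combo x y u v hab, hu, hv]
  simp

lemma convex_cross_neg (x y : Pt) : Convex ℝ {z | cross x y z < 0} := by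
  have := convex_cross_pos y x
  simpa only [cross_swap x y, Left.neg_pos_iff] using this

/-- An open half-plane together with one point of its boundary is convex. -/
lemma convex_cross_pos_or_eq (x y : Pt) {p : Pt} (hp : cross x y p = 0) :
    Convex ℝ {z | 0 < cross x y z ∨ z = p} := by
  rw [convex_iff_forall_pos]
  intro u hu v hv a b ha hb hab
  simp only [mem_ofPred_eq] at *
  rw [cross_combo x y u v hab]
  rcases hu with hu | rfl <;> rcases hv with hv | rfl
  · left; positivity
  · left; rw [hp]; simpa using mul_pos ha hu
  · left; rw [hp]; simpa using mul_pos hb hv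
  · right; rw [← add_smul, hab, one_smul]

lemma convex_cross_neg_or_eq (x y : Pt) {p : Pt} (hp : cross x y p = 0) :
    Convex ℝ {z | cross x y z < 0 ∨ z = p} := by
  have := convex_cross_pos_or_eq y x (p := p) (by rw [cross_swap, hp, neg_zero])
  simpa only [cross_swap x y, Left.neg_pos_iff] using this

lemma edgeSeg_subset {X : Finset Pt} {C : Set Pt} (hC : Convex ℝ C) (hX : (X : Set Pt) ⊆ C)
    {e : Sym2 Pt} (he : IsEdgeOf X e) : edgeSeg e ⊆ C := by
  induction e using Sym2.ind with
  | _ u v =>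
    exact hC.segment_subset (hX (he.2 u (Sym2.mem_mk_left u v)))
      (hX (he.2 v (Sym2.mem_mk_right u v)))

lemma HasAvoidingMatching.union {X Y : Finset Pt} {H : Finset (Sym2 Pt)}
    (hX : HasAvoidingMatching X H) (hY : HasAvoidingMatching Y H) {C D : Set Pt}
    (hC : Convex ℝ C) (hD : Convex ℝ D) (hXC : (X : Set Pt) ⊆ C) (hYD : (Y : Set Pt) ⊆ D)
    (hCD : Disjoint C D) : HasAvoidingMatching (X ∪ Y) H := by
  classical
  obtain ⟨M, ⟨hM1, hM2, hM3⟩, hMH⟩ := hX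
  obtain ⟨N, ⟨hN1, hN2, hN3⟩, hNH⟩ := hY
  have hdis : ∀ p, p ∈ X → p ∈ Y → False := fun p h1 h2 =>
    Set.disjoint_left.1 hCD (hXC h1) (hYD h2)
  refine ⟨M ∪ N, ⟨?_, ?_, ?_⟩, ?_⟩
  · intro e he
    rcases Finset.mem_union.1 he with he | he
    · exact ⟨(hM1 e he).1, fun p hp => Finset.mem_union_left _ ((hM1 e he).2 p hp)⟩
    · exact ⟨(hN1 e he).1, fun p hp => Finset.mem_union_right _ ((hN1 e he).2 p hp)⟩
  · intro p hp
    rcases Finset.mem_union.1 hp with hp | hp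
    · obtain ⟨e, ⟨he, hpe⟩, hu⟩ := hM2 p hp
      refine ⟨e, ⟨Finset.mem_union_left _ he, hpe⟩, ?_⟩
      rintro f ⟨hf, hpf⟩
      rcases Finset.mem_union.1 hf with hf | hf
      · exact hu f ⟨hf, hpf⟩
      · exact (hdis p hp ((hN1 f hf).2 p hpf)).elim
    · obtain ⟨e, ⟨he, hpe⟩, hu⟩ := hN2 p hp
      refine ⟨e, ⟨Finset.mem_union_right _ he, hpe⟩, ?_⟩
      rintro f ⟨hf, hpf⟩
      rcases Finset.mem_union.1 hf with hf | hf
      · exact (hdis p ((hM1 f hf).2 p hpf) hp).elim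
      · exact hu f ⟨hf, hpf⟩
  · have hMN : ∀ e ∈ M, ∀ f ∈ N, Disjoint (edgeSeg e) (edgeSeg f) := fun e he f hf =>
      hCD.mono (edgeSeg_subset hC hXC (hM1 e he)) (edgeSeg_subset hD hYD (hN1 f hf))
    rw [Finset.coe_union, Set.pairwise_union]
    exact ⟨hM3, hN3, fun e he f hf _ => ⟨hMN e he f hf, (hMN e he f hf).symm⟩⟩
  · intro e he
    rcases Finset.mem_union.1 he with he | he
    · exact hMH e he
    · exact hNH e he

lemma hasAvoidingMatching_pair {x y : Pt} (hxy : x ≠ y) {H : Finset (Sym2 Pt)}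
    (h : s(x, y) ∉ H) : HasAvoidingMatching {x, y} H := by
  refine ⟨{s(x, y)}, ⟨?_, ?_, ?_⟩, ?_⟩
  · simp [IsEdgeOf, hxy]
  · intro p hp
    refine ⟨s(x, y), ⟨by simp, by simpa using hp⟩, by simp⟩
  · simp
  · simpa [Avoids] using h

/-- The standard identification of the plane with `ℂ`, used for Euclidean lengths. -/
def toComplex (p : Pt) : ℂ := ⟨p.1, p.2⟩

lemma toComplex_injective : Function.Injective toComplex := by
  intro p q h
  simp only [toComplex, Complex.mk.injEq] at h
  exact Prod.ext h.1 h.2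

lemma toComplex_dist_add_dist {a b z : Pt} (hz : z ∈ segment ℝ a b) :
    dist (toComplex a) (toComplex z) + dist (toComplex z) (toComplex b) =
      dist (toComplex a) (toComplex b) := by
  obtain ⟨s, t, hs, ht, hst, rfl⟩ := hz
  rw [dist_add_dist_eq_iff, ← mem_segment_iff_wbtw]
  refine ⟨s, t, hs, ht, hst, ?_⟩
  apply Complex.ext <;> simp [toComplex]

lemma mem_segment_of_toComplex_dist {a z c : Pt}
    (h : dist (toComplex a) (toComplex z) + dist (toComplex z) (toComplex c) =
      dist (toComplex a) (toComplex c)) : z ∈ segment ℝ a c := by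
  rw [dist_add_dist_eq_iff, ← mem_segment_iff_wbtw] at h
  obtain ⟨s, t, hs, ht, hst, h⟩ := h
  refine ⟨s, t, hs, ht, hst, toComplex_injective ?_⟩
  rw [← h]
  apply Complex.ext <;> simp [toComplex]

/-- Swapping the partners of two crossing segments shortens them. -/
lemma dist_swap_lt {a b c d : Pt} (hgp : GenPos {a, b, c, d}) (hab : a ≠ b) (hac : a ≠ c)
    (had : a ≠ d) (hbc : b ≠ c) (hbd : b ≠ d) (hcd : c ≠ d)
    (h : ¬ Disjoint (segment ℝ a b) (segment ℝ c d)) :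
    dist (toComplex a) (toComplex d) + dist (toComplex c) (toComplex b) <
      dist (toComplex a) (toComplex b) + dist (toComplex c) (toComplex d) := by
  obtain ⟨z, hz1, hz2⟩ := Set.not_disjoint_iff.1 h
  have e1 := toComplex_dist_add_dist hz1
  have e2 := toComplex_dist_add_dist hz2
  have t1 := dist_triangle (toComplex a) (toComplex z) (toComplex d)
  have t2 := dist_triangle (toComplex c) (toComplex z) (toComplex b)
  refine lt_of_le_of_ne (by linarith) fun heq => ?_
  have hz3 : z ∈ segment ℝ a d := mem_segment_of_toComplex_dist (by linarith)
  have hz4 : z ∈ segment ℝ c b := mem_segment_of_toComplex_dist (by linarith)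
  have key : ∀ {u v w : Pt}, cross u v w ≠ 0 → z ∈ segment ℝ u v → z ∈ segment ℝ u w → z = u := by
    intro u v w hne h1 h2
    obtain ⟨s, t, hs, ht, hst, rfl⟩ := h1
    have := (convex_cross_eq_zero u v).segment_subset (cross_left u v) (cross_right u v)
      ⟨s, t, hs, ht, hst, rfl⟩
    obtain ⟨s', t', hs', ht', hst', h2⟩ := h2
    simp only [mem_ofPred_eq] at this
    rw [← h2, cross_combo _ _ _ _ hst', cross_left, mul_zero, zero_add] at this
    have ht0 : t' = 0 := (mul_eq_zero.1 this).resolve_right hne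
    have hs1 : s' = 1 := by linarith
    rw [← h2, ht0, hs1]; simp
  have h1 : z = a := key (hgp.cross_ne_zero (by simp) (by simp) (by simp) hab had.symm hbd.symm)
    hz1 hz3
  have h2 : z = c := key (hgp.cross_ne_zero (by simp) (by simp) (by simp) hcd hbc hbd)
    hz2 hz4
  exact hac (h1.symm.trans h2)

/-- Equinumerous red and blue points in general position have a non-crossing perfect matching
with red-blue edges only; it avoids `H` when `H` has no red-blue edge. -/
lemma hasAvoidingMatching_of_bipartition {R B : Finset Pt} {H : Finset (Sym2 Pt)}
    (hgp : GenPos (R ∪ B)) (hdisj : Disjoint R B) (hcard : R.card = B.card)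
    (hH : ∀ r ∈ R, ∀ b ∈ B, s(r, b) ∉ H) : HasAvoidingMatching (R ∪ B) H := by
  classical
  have : Nonempty (R ≃ B) := ⟨Finset.equivOfCardEq hcard⟩
  obtain ⟨σ, hσ⟩ := Finite.exists_min
    fun σ : R ≃ B => ∑ r : R, dist (toComplex r) (toComplex (σ r))
  have hne : ∀ (r : R) (b : B), (r : Pt) ≠ b := fun r b h =>
    Finset.disjoint_left.1 hdisj r.2 (h ▸ b.2)
  have hR : ∀ r : R, (r : Pt) ∈ R ∪ B := fun r => Finset.mem_union_left _ r.2
  have hB : ∀ b : B, (b : Pt) ∈ R ∪ B := fun b => Finset.mem_union_right _ b.2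
  refine ⟨Finset.univ.image fun r : R => s((r : Pt), (σ r : Pt)), ⟨?_, ?_, ?_⟩, ?_⟩
  · intro e he
    obtain ⟨r, -, rfl⟩ := Finset.mem_image.1 he
    refine ⟨by simpa using hne r (σ r), fun p hp => ?_⟩
    rcases Sym2.mem_iff.1 hp with rfl | rfl
    exacts [hR r, hB _]
  · intro p hp
    have hex : ∃ r : R, ∀ r' : R, p ∈ s((r' : Pt), (σ r' : Pt)) ↔ r' = r := by
      rcases Finset.mem_union.1 hp with hp | hp
      · refine ⟨⟨p, hp⟩, fun r' => ?_⟩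
        rw [Sym2.mem_iff]
        constructor
        · rintro (rfl | h)
          · rfl
          · exact (hne ⟨p, hp⟩ _ h).elim
        · rintro rfl; exact Or.inl rfl
      · refine ⟨σ.symm ⟨p, hp⟩, fun r' => ?_⟩
        rw [Sym2.mem_iff, Equiv.eq_symm_apply]
        constructor
        · rintro (h | rfl)
          · exact (hne _ ⟨p, hp⟩ h.symm).elim
          · rfl
        · intro h; right; rw [h]
    obtain ⟨r, hr⟩ := hex
    refine ⟨s((r : Pt), (σ r : Pt)), ⟨Finset.mem_image_of_mem _ (Finset.mem_univ r),
      (hr r).2 rfl⟩, ?_⟩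
    rintro f ⟨hf, hpf⟩
    obtain ⟨r', -, rfl⟩ := Finset.mem_image.1 hf
    rw [(hr r').1 hpf]
  · intro e he f hf hef
    obtain ⟨r, -, rfl⟩ := Finset.mem_image.1 he
    obtain ⟨r', -, rfl⟩ := Finset.mem_image.1 hf
    have hrr : r ≠ r' := fun h => hef (by rw [h])
    by_contra hcross
    have hlt := dist_swap_lt (a := r) (b := σ r) (c := r') (d := σ r')
      (hgp.mono (by
        intro z hz
        simp only [Finset.mem_insert, Finset.mem_singleton] at hz
        rcases hz with rfl | rfl | rfl | rfl
        exacts [hR _, hB _, hR _, hB _]))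
      (hne _ _) (fun h => hrr (Subtype.ext h)) (hne _ _) (hne _ _).symm
      (fun h => hrr (σ.injective (Subtype.ext h))) (hne _ _) hcross
    have hmin := hσ ((Equiv.swap r r').trans σ)
    have hsplit : ∀ g : R → ℝ,
        ∑ x, g x = g r + g r' + ∑ x ∈ (Finset.univ.erase r).erase r', g x := by
      intro g
      rw [← Finset.add_sum_erase _ g (Finset.mem_univ r),
        ← Finset.add_sum_erase _ g (Finset.mem_erase.2 ⟨hrr.symm, Finset.mem_univ r'⟩), add_assoc]
    rw [hsplit, hsplit] at hmin
    have hrest : ∑ x ∈ (Finset.univ.erase r).erase r',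
        dist (toComplex x) (toComplex (((Equiv.swap r r').trans σ) x)) =
        ∑ x ∈ (Finset.univ.erase r).erase r', dist (toComplex x) (toComplex (σ x)) := by
      refine Finset.sum_congr rfl fun x hx => ?_
      simp only [Finset.mem_erase, Finset.mem_univ, and_true] at hx
      rw [Equiv.trans_apply, Equiv.swap_apply_of_ne_of_ne hx.2 hx.1]
    rw [hrest] at hmin
    simp only [Equiv.trans_apply, Equiv.swap_apply_left, Equiv.swap_apply_right] at hmin
    linarith
  · intro e he
    obtain ⟨r, -, rfl⟩ := Finset.mem_image.1 he
    exact hH r r.2 _ (σ r).2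

/-- A discrete intermediate value theorem: `±1` steps taken in the order of `s`, from a
non-positive start to a positive end, step up from `0` to `1` somewhere. -/
lemma exists_step_zero_one {ι : Type*} [DecidableEq ι] (S : Finset ι) (s : ι → ℝ)
    (hs : Set.InjOn s S) (d : ι → ℤ) (hd : ∀ i ∈ S, d i = 1 ∨ d i = -1) (a : ℤ) (ha : a ≤ 0)
    (hS : 1 ≤ a + ∑ i ∈ S, d i) :
    ∃ q ∈ S, d q = 1 ∧ a + ∑ r ∈ S with s r < s q, d r = 0 := by
  induction S using Finset.induction_on_max_value s with
  | empty => simp at hS; omega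
  | insert m S hm hmax ih =>
    have hlt : ∀ r ∈ S, s r < s m := fun r hr => lt_of_le_of_ne (hmax r hr) fun h =>
      hm (hs (by simp [hr]) (by simp) h ▸ hr)
    rw [Finset.sum_insert hm] at hS
    by_cases h1 : 1 ≤ a + ∑ i ∈ S, d i
    · obtain ⟨q, hq, hq1, hq2⟩ := ih (hs.mono (by simp)) (fun i hi => hd i (by simp [hi])) h1
      refine ⟨q, by simp [hq], hq1, ?_⟩
      rwa [Finset.filter_insert, if_neg (not_lt.2 (hmax q hq))]
    · have := hd m (by simp)
      refine ⟨m, by simp, by omega, ?_⟩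
      rw [Finset.filter_insert, if_neg (lt_irrefl _), Finset.filter_true_of_mem hlt]
      omega

/-- Rotating a line about a point `x` of colour `-1` in a balanced `±1`-coloured set: some line
through `x` and another point `q` either balances both open sides, with `q` of colour `1`, or leaves
excess `1` on both sides, with `q` of colour `-1`. -/
lemma exists_balanced_line {X : Finset Pt} (hX : GenPos X) (c : Pt → ℤ)
    (hc : ∀ z ∈ X, c z = 1 ∨ c z = -1) {x : Pt} (hx : x ∈ X) (hcx : c x = -1)
    (hsum : ∑ z ∈ X, c z = 0) :
    ∃ q ∈ X, q ≠ x ∧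
      ((c q = 1 ∧ ∑ z ∈ X with 0 < cross x q z, c z = 0 ∧
          ∑ z ∈ X with cross x q z < 0, c z = 0) ∨
        (c q = -1 ∧ ∑ z ∈ X with 0 < cross x q z, c z = 1 ∧
          ∑ z ∈ X with cross x q z < 0, c z = 1)) := by
  obtain ⟨t, ht⟩ := Set.infinite_univ.exists_notMem_finset
    (X.image fun z => -(z.1 - x.1) / (z.2 - x.2))
  set f : Pt → ℝ := fun z => (z.1 - x.1) + t * (z.2 - x.2) with hf
  set g : Pt → ℝ := fun z => z.2 - x.2 with hg
  set s : Pt → ℝ := fun z => g z / f z with hs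
  have hf0 : ∀ z ∈ X.erase x, f z ≠ 0 := by
    intro z hz h0
    obtain ⟨hzx, hz⟩ := Finset.mem_erase.1 hz
    by_cases h2 : z.2 - x.2 = 0
    · simp only [hf, h2, mul_zero, add_zero] at h0
      exact hzx (Prod.ext (by linarith) (by linarith))
    · refine ht.2 (Finset.mem_image.2 ⟨z, hz, ?_⟩)
      simp only [hf] at h0
      field_simp
      linarith
  have hcross : ∀ q ∈ X.erase x, ∀ z ∈ X.erase x,
      cross x q z = f q * f z * (s z - s q) := by
    intro q hq z hz
    have h1 := hf0 q hq
    have h2 := hf0 z hz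
    have : f q * f z * (s z - s q) = f q * g z - g q * f z := by
      simp only [hs]; field_simp
    rw [this]; simp only [hf, hg, cross]; ring
  have hinj : Set.InjOn s (X.erase x : Finset Pt) := by
    intro q hq z hz h
    by_contra hne
    have h0 := hcross q hq z hz
    rw [h, sub_self, mul_zero] at h0
    have hq' := Finset.mem_erase.1 (Finset.mem_coe.1 hq)
    have hz' := Finset.mem_erase.1 (Finset.mem_coe.1 hz)
    exact hX.cross_ne_zero hx hq'.2 hz'.2 hq'.1.symm hz'.1 (Ne.symm hne) h0
  set d : Pt → ℤ := fun z => if 0 < f z then -c z else c z with hd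
  have hd1 : ∀ z ∈ X.erase x, d z = 1 ∨ d z = -1 := by
    intro z hz
    have := hc z (Finset.mem_of_mem_erase hz)
    simp only [hd]; split_ifs <;> omega
  set F : ℤ := ∑ z ∈ X.erase x with 0 < f z, c z with hF
  have hY : ∑ z ∈ X.erase x, c z = 1 := by
    have := Finset.add_sum_erase X c hx
    omega
  have hFd : F + ∑ z ∈ X.erase x, d z = 1 - F := by
    rw [← hY, hF, Finset.sum_filter, eq_sub_iff_add_eq, ← Finset.sum_add_distrib,
      ← Finset.sum_add_distrib]
    refine Finset.sum_congr rfl fun z _ => ?_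
    simp only [hd]; split_ifs <;> ring
  have hstep : ∃ q ∈ X.erase x,
      (d q = 1 ∧ F + ∑ r ∈ X.erase x with s r < s q, d r = 0) ∨
      (d q = -1 ∧ F + ∑ r ∈ X.erase x with s r < s q, d r = 1) := by
    rcases le_or_gt F 0 with h | h
    · obtain ⟨q, hq, h1, h2⟩ := exists_step_zero_one (X.erase x) s hinj d hd1 F h (by omega)
      exact ⟨q, hq, Or.inl ⟨h1, h2⟩⟩
    · obtain ⟨q, hq, h1, h2⟩ := exists_step_zero_one (X.erase x) s hinj (fun z => -d z)
        (fun z hz => by have := hd1 z hz; omega) (1 - F) (by omega)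
        (by rw [Finset.sum_neg_distrib]; omega)
      rw [Finset.sum_neg_distrib] at h2
      exact ⟨q, hq, Or.inr ⟨by omega, by omega⟩⟩
  obtain ⟨q, hq, hstep⟩ := hstep
  have hqx := (Finset.mem_erase.1 hq).1
  have hqX := (Finset.mem_erase.1 hq).2
  refine ⟨q, hqX, hqx, ?_⟩
  have hP : ∑ z ∈ X with 0 < cross x q z, c z =
      ∑ z ∈ X.erase x, if 0 < cross x q z then c z else 0 := by
    rw [Finset.sum_filter, ← Finset.add_sum_erase X _ hx]; simp
  have hN : ∑ z ∈ X with cross x q z < 0, c z =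
      ∑ z ∈ X.erase x, if cross x q z < 0 then c z else 0 := by
    rw [Finset.sum_filter, ← Finset.add_sum_erase X _ hx]; simp
  have hQ : c q = ∑ z ∈ X.erase x, if z = q then c z else 0 := by
    rw [Finset.sum_ite_eq' (X.erase x) q c, if_pos hq]
  have htot : (∑ z ∈ X with 0 < cross x q z, c z) + (∑ z ∈ X with cross x q z < 0, c z) + c q =
      1 := by
    rw [hP, hN, hQ, ← hY, ← Finset.sum_add_distrib, ← Finset.sum_add_distrib]
    refine Finset.sum_congr rfl fun z hz => ?_
    obtain ⟨hzx, hzX⟩ := Finset.mem_erase.1 hz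
    by_cases hzq : z = q
    · subst hzq; simp
    · rcases (hX.cross_ne_zero hx hqX hzX hqx.symm hzx hzq).lt_or_gt with h | h <;>
        simp [h, h.not_gt, hzq]
  have hcq := hc q hqX
  have hlast : (0 < f q → F + ∑ r ∈ X.erase x with s r < s q, d r =
        (∑ z ∈ X with 0 < cross x q z, c z) + c q) ∧
      (¬ 0 < f q → F + ∑ r ∈ X.erase x with s r < s q, d r =
        ∑ z ∈ X with cross x q z < 0, c z) := by
    constructor
    · intro hfq
      rw [hP, hQ, hF, Finset.sum_filter, Finset.sum_filter, ← Finset.sum_add_distrib,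
        ← Finset.sum_add_distrib]
      refine Finset.sum_congr rfl fun z hz => ?_
      rw [hcross q hq z hz]
      by_cases hzq : z = q
      · subst hzq; simp [hfq]
      · have hsz : s z ≠ s q := fun h => hzq (hinj hz hq h)
        rcases (hf0 z hz).lt_or_gt with hfz | hfz <;> rcases hsz.lt_or_gt with hlt | hlt
        · have : 0 < f q * f z * (s z - s q) :=
            mul_pos_of_neg_of_neg (mul_neg_of_pos_of_neg hfq hfz) (by linarith)
          simp [hd, hfz.not_gt, hlt, this, hzq]
        · have : f q * f z * (s z - s q) < 0 :=
            mul_neg_of_neg_of_pos (mul_neg_of_pos_of_neg hfq hfz) (by linarith)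
          simp [hfz.not_gt, hlt.not_gt, this.not_gt, hzq]
        · have : f q * f z * (s z - s q) < 0 :=
            mul_neg_of_pos_of_neg (mul_pos hfq hfz) (by linarith)
          simp [hd, hfz, hlt, this.not_gt, hzq]
        · have : 0 < f q * f z * (s z - s q) := mul_pos (mul_pos hfq hfz) (by linarith)
          simp [hfz, hlt.not_gt, this, hzq]
    · intro hfq
      have hfq : f q < 0 := lt_of_le_of_ne (not_lt.1 hfq) (hf0 q hq)
      rw [hN, hF, Finset.sum_filter, Finset.sum_filter, ← Finset.sum_add_distrib]
      refine Finset.sum_congr rfl fun z hz => ?_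
      rw [hcross q hq z hz]
      by_cases hzq : z = q
      · subst hzq; simp [hfq.not_gt]
      · have hsz : s z ≠ s q := fun h => hzq (hinj hz hq h)
        rcases (hf0 z hz).lt_or_gt with hfz | hfz <;> rcases hsz.lt_or_gt with hlt | hlt
        · have : f q * f z * (s z - s q) < 0 :=
            mul_neg_of_pos_of_neg (mul_pos_of_neg_of_neg hfq hfz) (by linarith)
          simp [hd, hfz.not_gt, hlt, this]
        · have : 0 < f q * f z * (s z - s q) :=
            mul_pos (mul_pos_of_neg_of_neg hfq hfz) (by linarith)
          simp [hfz.not_gt, hlt.not_gt, this.not_gt]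
        · have : 0 < f q * f z * (s z - s q) :=
            mul_pos_of_neg_of_neg (mul_neg_of_neg_of_pos hfq hfz) (by linarith)
          simp [hd, hfz, hlt, this.not_gt]
        · have : f q * f z * (s z - s q) < 0 :=
            mul_neg_of_neg_of_pos (mul_neg_of_neg_of_pos hfq hfz) (by linarith)
          simp [hfz, hlt.not_gt, this]
  have hdq : d q = if 0 < f q then -c q else c q := rfl
  by_cases hfq : 0 < f q
  · rw [if_pos hfq] at hdq
    have := hlast.1 hfq
    omega
  · rw [if_neg hfq] at hdq
    have := hlast.2 hfq
    omega

/-- If the average of positive integers is less than `2`, every possible subset sum occurs. -/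
lemma exists_subset_sum_eq {ι : Type*} [DecidableEq ι] (S : Finset ι) (a : ι → ℕ)
    (ha : ∀ i ∈ S, 1 ≤ a i) (h : ∑ i ∈ S, a i < 2 * S.card) (k : ℕ) (hk : k ≤ ∑ i ∈ S, a i) :
    ∃ T ⊆ S, ∑ i ∈ T, a i = k := by
  induction S using Finset.strongInduction generalizing k with
  | H S ih =>
    by_cases hall : ∃ i ∈ S, 2 ≤ a i
    · obtain ⟨i, hi, hai⟩ := hall
      have hsum := Finset.add_sum_erase S a hi
      have hcard := Finset.card_erase_add_one hi
      have hge : (S.erase i).card ≤ ∑ j ∈ S.erase i, a j := by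
        simpa using Finset.card_nsmul_le_sum (S.erase i) a 1
          fun j hj => ha j (Finset.mem_of_mem_erase hj)
      have ih' := ih (S.erase i) (Finset.erase_ssubset hi)
        (fun j hj => ha j (Finset.mem_of_mem_erase hj)) (by omega)
      by_cases hki : k ≤ ∑ j ∈ S.erase i, a j
      · obtain ⟨T, hT, hTk⟩ := ih' k hki
        exact ⟨T, hT.trans (Finset.erase_subset _ _), hTk⟩
      · obtain ⟨T, hT, hTk⟩ := ih' (k - a i) (by omega)
        refine ⟨insert i T, Finset.insert_subset hi (hT.trans (Finset.erase_subset _ _)), ?_⟩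
        rw [Finset.sum_insert (fun h => by simpa using hT h)]
        omega
    · push Not at hall
      have h1 : ∀ i ∈ S, a i = 1 := fun i hi => by
        have := ha i hi
        have := hall i hi
        omega
      rw [Finset.sum_congr rfl h1, Finset.sum_const, smul_eq_mul, mul_one] at hk
      obtain ⟨T, hT, hTk⟩ := Finset.exists_subset_card_eq hk
      refine ⟨T, hT, ?_⟩
      rw [Finset.sum_congr rfl fun i hi => h1 i (hT hi)]
      simpa using hTk

lemma eq_succ_of_no_subset_sum {ι : Type*} [DecidableEq ι] (S : Finset ι) (a : ι → ℕ) {n : ℕ}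
    (ha : ∀ i ∈ S, 1 ≤ a i) (hsum : ∑ i ∈ S, a i = 2 * n) (hn : n ≤ S.card)
    (hno : ¬ ∃ T ⊆ S, ∑ i ∈ T, a i = n) :
    S.card = n ∧ ∀ j ∈ S, 3 ≤ a j → a j = n + 1 ∧ ∀ i ∈ S, i ≠ j → a i = 1 := by
  have hSn : S.card = n := by
    by_contra h
    exact hno (exists_subset_sum_eq S a ha (by omega) n (by omega))
  refine ⟨hSn, fun j hj haj => ?_⟩
  have hsum' := Finset.add_sum_erase S a hj
  have hcard := Finset.card_erase_add_one hj
  have hge : (S.erase j).card ≤ ∑ i ∈ S.erase j, a i := by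
    simpa using Finset.card_nsmul_le_sum (S.erase j) a 1
      fun i hi => ha i (Finset.mem_of_mem_erase hi)
  have hj1 : a j = n + 1 := by
    by_contra h
    obtain ⟨T, hT, hTn⟩ := exists_subset_sum_eq (S.erase j) a
      (fun i hi => ha i (Finset.mem_of_mem_erase hi)) (by omega) n (by omega)
    exact hno ⟨T, hT.trans (Finset.erase_subset _ _), hTn⟩
  refine ⟨hj1, fun i hi hij => ?_⟩
  have hi' : i ∈ S.erase j := Finset.mem_erase.2 ⟨hij, hi⟩
  have h1 : ∑ i ∈ S.erase j, 1 = ∑ i ∈ S.erase j, a i := by simp; omega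
  exact ((Finset.sum_eq_sum_iff_of_le fun i hi => ha i (Finset.mem_of_mem_erase hi)).1 h1 i
    hi').symm

lemma card_le_card_image_merge {α : Type*} [DecidableEq α] (Y : Finset Pt) (l : Pt → α)
    (b c : α) :
    (Y.image l).card ≤ (Y.image fun z => if l z = c then b else l z).card + 1 := by
  have hsub : (Y.image l).erase c ⊆ Y.image fun z => if l z = c then b else l z := by
    intro i hi
    obtain ⟨hic, hi⟩ := Finset.mem_erase.1 hi
    obtain ⟨z, hz, rfl⟩ := Finset.mem_image.1 hi
    exact Finset.mem_image.2 ⟨z, hz, if_neg hic⟩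
  have h1 := Finset.card_le_card hsub
  have h2 := Finset.pred_card_le_card_erase (s := Y.image l) (a := c)
  omega

/-- A graph with `m` edges on `Y` has at least `|Y| - m` components. -/
lemma exists_labelling (Y : Finset Pt) (F : Finset (Sym2 Pt)) :
    ∃ l : Pt → Pt, (∀ u v, s(u, v) ∈ F → l u = l v) ∧ Y.card ≤ (Y.image l).card + F.card := by
  classical
  induction F using Finset.induction_on with
  | empty => exact ⟨id, by simp, by simp⟩
  | insert e F he ih =>
    obtain ⟨l, hl, hcard⟩ := ih
    induction e using Sym2.ind with
    | _ x y =>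
      refine ⟨fun z => if l z = l y then l x else l z, ?_, ?_⟩
      · intro u v huv
        rcases Finset.mem_insert.1 huv with huv | huv
        · rcases Sym2.eq_iff.1 huv with ⟨rfl, rfl⟩ | ⟨rfl, rfl⟩ <;> simp
        · simp only [hl u v huv]
      · have := card_le_card_image_merge Y l (l x) (l y)
        rw [Finset.card_insert_of_notMem he]
        omega

/-- Without an avoiding matching, a labelling constant along `H` with at least `n` labels has
exactly `n`, and if it has a class of size at least `3`, then this class has size `n + 1` and all others are
singletons. -/
lemma label_classes {n : ℕ} {X : Finset Pt} (hXcard : X.card = 2 * n) (hgp : GenPos X)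
    {H : Finset (Sym2 Pt)} (hno : ¬ HasAvoidingMatching X H) {α : Type*} [DecidableEq α]
    (l : Pt → α) (hl : ∀ u v, s(u, v) ∈ H → l u = l v) (hcard : n ≤ (X.image l).card) :
    (X.image l).card = n ∧ ∀ j ∈ X.image l, 3 ≤ (X.filter (l · = j)).card →
      (X.filter (l · = j)).card = n + 1 ∧
        ∀ i ∈ X.image l, i ≠ j → (X.filter (l · = i)).card = 1 := by
  refine eq_succ_of_no_subset_sum (X.image l) (fun i => (X.filter (l · = i)).card) ?_ ?_ hcard ?_
  · intro i hi
    obtain ⟨z, hz, rfl⟩ := Finset.mem_image.1 hi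
    exact Finset.card_pos.2 ⟨z, by simp [hz]⟩
  · rw [← hXcard]; exact (Finset.card_eq_sum_card_image l X).symm
  · rintro ⟨T, hT, hsum⟩
    have hT' : (X.filter (l · ∈ T)).card = n := by
      rw [← hsum, Finset.card_eq_sum_card_fiberwise (f := l) (t := T) (by intro z; simp)]
      refine Finset.sum_congr rfl fun i hi => ?_
      rw [Finset.filter_filter]
      congr 1
      refine Finset.filter_congr fun z _ => ⟨fun h => h.2, fun h => ⟨h ▸ hi, h⟩⟩
    have hadd := Finset.card_filter_add_card_filter_not (s := X) (l · ∈ T)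
    have hun := Finset.filter_union_filter_not_eq (l · ∈ T) X
    refine hno ?_
    rw [← hun]
    refine hasAvoidingMatching_of_bipartition (by rwa [hun])
      (Finset.disjoint_filter_filter_not _ _ _) (by omega) ?_
    intro r hr b hb hrb
    simp only [Finset.mem_filter] at hr hb
    exact hb.2 (hl r b hrb ▸ hr.2)

/-- `x` and `y` lie in the disjoint vertex sets `S` and `S'` of total size `n + 1`, which contain
every edge of `H` other than `s(x, y)`. -/
structure IsSplit (n : ℕ) (X : Finset Pt) (H : Finset (Sym2 Pt)) (S S' : Finset Pt) (x y : Pt) :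
    Prop where
  left_subset : S ⊆ X
  right_subset : S' ⊆ X
  disjoint : Disjoint S S'
  mem_left : x ∈ S
  mem_right : y ∈ S'
  card_add_card : S.card + S'.card = n + 1
  edge_mem : ∀ u v, s(u, v) ∈ H → s(u, v) ≠ s(x, y) → (u ∈ S ∧ v ∈ S) ∨ (u ∈ S' ∧ v ∈ S')

namespace IsSplit

variable {n : ℕ} {X S S' : Finset Pt} {H : Finset (Sym2 Pt)} {x y : Pt}

lemma symm (h : IsSplit n X H S S' x y) : IsSplit n X H S' S y x where
  left_subset := h.right_subset
  right_subset := h.left_subset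
  disjoint := h.disjoint.symm
  mem_left := h.mem_right
  mem_right := h.mem_left
  card_add_card := by rw [add_comm, h.card_add_card]
  edge_mem u v huv hne := (h.edge_mem u v huv (by rwa [Sym2.eq_swap (a := x)])).symm

lemma two_le_card_left (h : IsSplit n X H S S' x y) {g : Sym2 Pt} (hg : g ∈ H)
    (hne : g ≠ s(x, y)) (hdiag : ¬ g.IsDiag) (hx : x ∈ g) : 2 ≤ S.card := by
  obtain ⟨z, rfl⟩ := Sym2.mem_iff_exists.1 hx
  have hxz : x ≠ z := by simpa using hdiag
  have hz : z ∈ S := by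
    rcases h.edge_mem x z hg hne with h1 | h1
    · exact h1.2
    · exact (Finset.disjoint_left.1 h.disjoint h.mem_left h1.1).elim
  exact Finset.one_lt_card.2 ⟨x, h.mem_left, z, hz, hxz⟩

lemma card_rest (h : IsSplit n X H S S' x y) (hXcard : X.card = 2 * n) :
    (X \ (S ∪ S')).card + 1 = n := by
  have h1 := Finset.card_sdiff_add_card_eq_card
    (Finset.union_subset h.left_subset h.right_subset)
  rw [Finset.card_union_of_disjoint h.disjoint] at h1
  have := h.card_add_card
  have := Finset.card_pos.2 ⟨x, h.mem_left⟩
  have := Finset.card_pos.2 ⟨y, h.mem_right⟩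
  omega

end IsSplit

lemma exists_isSplit {n : ℕ} {X : Finset Pt} (hXcard : X.card = 2 * n) (hgp : GenPos X)
    {H : Finset (Sym2 Pt)} (hH : ∀ e ∈ H, IsEdgeOf X e) (hHcard : H.card = n)
    (hno : ¬ HasAvoidingMatching X H) {p q₁ q₂ : Pt} (hp₁ : s(p, q₁) ∈ H) (hp₂ : s(p, q₂) ∈ H)
    (hq : q₁ ≠ q₂) {x y : Pt} (hxy : s(x, y) ∈ H) :
    ∃ S S' : Finset Pt, IsSplit n X H S S' x y := by
  have hedge : ∀ {u v : Pt}, s(u, v) ∈ H → u ≠ v ∧ u ∈ X ∧ v ∈ X := fun {u v} h =>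
    ⟨by simpa using (hH _ h).1, (hH _ h).2 u (by simp), (hH _ h).2 v (by simp)⟩
  obtain ⟨l, hl, hlcard⟩ := exists_labelling X (H.erase s(x, y))
  have hcard := Finset.card_erase_add_one hxy
  have hne : l x ≠ l y := by
    intro h
    have hl' : ∀ u v, s(u, v) ∈ H → l u = l v := by
      intro u v huv
      by_cases he : s(u, v) = s(x, y)
      · rcases Sym2.eq_iff.1 he with ⟨rfl, rfl⟩ | ⟨rfl, rfl⟩
        exacts [h, h.symm]
      · exact hl u v (Finset.mem_erase.2 ⟨he, huv⟩)
    have := (label_classes hXcard hgp hno l hl' (by omega)).1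
    omega
  set m : Pt → Pt := fun z => if l z = l y then l x else l z with hm
  have hmx : ∀ z, m z = l x ↔ l z = l x ∨ l z = l y := by
    intro z
    by_cases h : l z = l y <;> simp [hm, h]
  have hmH : ∀ u v, s(u, v) ∈ H → m u = m v := by
    intro u v huv
    by_cases he : s(u, v) = s(x, y)
    · rcases Sym2.eq_iff.1 he with ⟨rfl, rfl⟩ | ⟨rfl, rfl⟩ <;> simp [hm]
    · simp only [hm, hl u v (Finset.mem_erase.2 ⟨he, huv⟩)]
  have hmcard : (X.image l).card ≤ (X.image m).card + 1 :=
    card_le_card_image_merge X l (l x) (l y)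
  obtain ⟨-, hclass⟩ := label_classes hXcard hgp hno m hmH (by omega)
  obtain ⟨hpq₁, hpX, hq₁⟩ := hedge hp₁
  obtain ⟨hpq₂, -, hq₂⟩ := hedge hp₂
  obtain ⟨hxy', hxX, hyX⟩ := hedge hxy
  obtain ⟨hbig, hsmall⟩ := hclass (m p) (Finset.mem_image_of_mem m hpX)
    (Finset.two_lt_card.2 ⟨p, by simp [hpX], q₁, by simp [hq₁, hmH p q₁ hp₁], q₂,
      by simp [hq₂, hmH p q₂ hp₂], hpq₁, hpq₂, hq⟩)
  have hmem : ∀ u v, s(u, v) ∈ H → m u = m p := by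
    intro u v huv
    by_contra h
    obtain ⟨huv', hu, hv⟩ := hedge huv
    have h1 := hsmall (m u) (Finset.mem_image_of_mem m hu) h
    have h2 : 1 < (X.filter (m · = m u)).card :=
      Finset.one_lt_card.2 ⟨u, by simp [hu], v, by simp [hv, hmH u v huv], huv'⟩
    exact absurd h1 (ne_of_gt h2)
  have hpx : m p = l x := by rw [← hmem x y hxy, hmx]; exact Or.inl rfl
  have hdisj : Disjoint (X.filter (l · = l x)) (X.filter (l · = l y)) :=
    Finset.disjoint_filter.2 fun z _ h1 h2 => hne (h1.symm.trans h2)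
  refine ⟨X.filter (l · = l x), X.filter (l · = l y), Finset.filter_subset _ _,
    Finset.filter_subset _ _, hdisj, by simp [hxX], by simp [hyX], ?_, ?_⟩
  · rw [← Finset.card_union_of_disjoint hdisj, ← Finset.filter_or, ← hbig]
    congr 1
    exact Finset.filter_congr fun z _ => by rw [hpx, hmx]
  · intro u v huv hne'
    obtain ⟨-, hu, hv⟩ := hedge huv
    have huv' := hl u v (Finset.mem_erase.2 ⟨hne', huv⟩)
    have := (hmx u).1 ((hmem u v huv).trans hpx)
    simp only [Finset.mem_filter, hu, hv, true_and, ← huv', and_self]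
    exact this

lemma sum_filter_color {B R : Finset Pt} (hdisj : Disjoint B R) (P : Pt → Prop) [DecidablePred P] :
    ∑ z ∈ B ∪ R with P z, (if z ∈ R then 1 else -1 : ℤ) =
      (R.filter P).card - (B.filter P).card := by
  rw [Finset.filter_union, Finset.sum_union (Finset.disjoint_filter_filter hdisj),
    Finset.sum_congr rfl (g := fun _ => (-1 : ℤ)) (s₁ := B.filter P), Finset.sum_congr rfl
    (g := fun _ => (1 : ℤ)) (s₁ := R.filter P)]
  · simp; ring
  · intro z hz
    rw [if_pos (Finset.mem_filter.1 hz).1]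
  · intro z hz
    rw [if_neg (Finset.disjoint_left.1 hdisj (Finset.mem_filter.1 hz).1)]

lemma HasAvoidingMatching.union_line {L R : Finset Pt} {H : Finset (Sym2 Pt)} {x y : Pt}
    (hL : HasAvoidingMatching L H) (hR : HasAvoidingMatching R H) (hxy : x ≠ y)
    (hH : s(x, y) ∉ H) (hpos : ∀ z ∈ L, 0 < cross x y z) (hneg : ∀ z ∈ R, cross x y z < 0) :
    HasAvoidingMatching (L ∪ {x, y} ∪ R) H := by
  have hpair : ∀ z ∈ ({x, y} : Finset Pt), cross x y z = 0 := by simp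
  refine (hL.union (hasAvoidingMatching_pair hxy hH) (convex_cross_pos x y)
    (convex_cross_eq_zero x y) hpos hpair ?_).union hR (convex_cross_nonneg x y)
    (convex_cross_neg x y) ?_ hneg ?_
  · exact Set.disjoint_left.2 fun z (hz : 0 < _) (hz' : _ = 0) => hz.ne' hz'
  · intro z hz
    rcases Finset.mem_union.1 (Finset.mem_coe.1 hz) with hz | hz
    · exact (hpos z hz).le
    · exact (hpair z hz).ge
  · exact Set.disjoint_left.2 fun z (hz : 0 ≤ cross x y z) (hz' : cross x y z < 0) => hz.not_gt hz'

/-- If `s(x, y)` is the only bichromatic edge of `H` and `H` meets all non-crossing perfect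
matchings, then both sides of the line `xy` are balanced. -/
lemma balanced_sides {X B R : Finset Pt} {H : Finset (Sym2 Pt)} (hgp : GenPos X)
    (hno : ¬ HasAvoidingMatching X H) (hX : B ∪ R = X) (hdisj : Disjoint B R)
    (hcard : B.card = R.card) {x y : Pt} (hx : x ∈ B) (hy : y ∈ R)
    (hH : ∀ b ∈ B, ∀ r ∈ R, s(b, r) ∈ H → b = x ∧ r = y) :
    (B.filter fun z => 0 < cross x y z).card = (R.filter fun z => 0 < cross x y z).card ∧
      (B.filter fun z => cross x y z < 0).card = (R.filter fun z => cross x y z < 0).card := by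
  have hBX : ∀ {z}, z ∈ B → z ∈ X := fun h => hX ▸ Finset.mem_union_left _ h
  have hRX : ∀ {z}, z ∈ R → z ∈ X := fun h => hX ▸ Finset.mem_union_right _ h
  have hBR : ∀ {z}, z ∈ B → z ∉ R := fun h => Finset.disjoint_left.1 hdisj h
  have hgood : ∀ B' R' : Finset Pt, B' ⊆ B → R' ⊆ R → B'.card = R'.card → (x ∉ B' ∨ y ∉ R') →
      HasAvoidingMatching (B' ∪ R') H := by
    intro B' R' hB' hR' hc hxy
    refine hasAvoidingMatching_of_bipartition
      (hgp.mono (Finset.union_subset (fun z hz => hBX (hB' hz)) fun z hz => hRX (hR' hz)))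
      (hdisj.mono hB' hR') hc fun b hb r hr hbr => ?_
    obtain ⟨rfl, rfl⟩ := hH b (hB' hb) r (hR' hr) hbr
    exact hxy.elim (· hb) (· hr)
  obtain ⟨q, hqX, hqx, hq⟩ := exists_balanced_line hgp (fun z => if z ∈ R then 1 else -1)
    (fun z _ => by split_ifs <;> simp) (hBX hx) (if_neg (hBR hx)) (by
      have := sum_filter_color hdisj fun _ => True
      simp only [Finset.filter_true, hX] at this
      rw [this, hcard, sub_self])
  rw [← hX, sum_filter_color hdisj, sum_filter_color hdisj] at hq
  have htri : ∀ z ∈ X, z ≠ x → z ≠ q → 0 < cross x q z ∨ cross x q z < 0 := fun z hz h1 h2 =>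
    (hgp.cross_ne_zero (hBX hx) hqX hz hqx.symm h1 h2).lt_or_gt.symm
  rcases hq with ⟨hcq, hpos, hneg⟩ | ⟨hcq, hpos, hneg⟩
  · by_cases hqy : q = y
    · subst hqy
      omega
    have hqR : q ∈ R := by
      by_contra h
      simp [h] at hcq
    refine (hno ?_).elim
    have h1 := hgood (B.filter fun z => 0 < cross x q z) (R.filter fun z => 0 < cross x q z)
      (Finset.filter_subset _ _) (Finset.filter_subset _ _) (by omega) (Or.inl (by simp))
    have h2 := hgood (B.filter fun z => cross x q z < 0) (R.filter fun z => cross x q z < 0)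
      (Finset.filter_subset _ _) (Finset.filter_subset _ _) (by omega) (Or.inl (by simp))
    rw [← Finset.filter_union, hX] at h1 h2
    convert h1.union_line h2 hqx.symm (fun h => hqy (hH x hx q hqR h).2)
      (fun z hz => (Finset.mem_filter.1 hz).2) (fun z hz => (Finset.mem_filter.1 hz).2) using 1
    ext z
    simp only [Finset.mem_union, Finset.mem_filter, Finset.mem_insert, Finset.mem_singleton]
    constructor
    · intro hz
      by_cases hzx : z = x
      · simp [hzx]
      by_cases hzq : z = q
      · simp [hzq]
      rcases htri z hz hzx hzq with h | h <;> simp [hz, h]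
    · rintro ((h | rfl | rfl) | h)
      exacts [h.1, hBX hx, hqX, h.1]
  · have hqR : q ∉ R := by
      intro h
      simp [h] at hcq
    have hqB : q ∈ B := (Finset.mem_union.1 (hX.symm ▸ hqX)).resolve_right hqR
    refine (hno ?_).elim
    have hyx : y ≠ x := fun h => hBR hx (h ▸ hy)
    have hyq : y ≠ q := fun h => hqR (h ▸ hy)
    have hins : ∀ (a : Pt) (_ : a ∈ B) (P : Pt → Prop) [DecidablePred P] (_ : ¬ P a)
        (_ : (R.filter P).card = (B.filter P).card + 1), (x ≠ a ∧ ¬ P x) ∨ ¬ P y →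
        HasAvoidingMatching (insert a (X.filter P)) H := by
      intro a ha P _ hPa hc hxy
      rw [← hX, Finset.filter_union, ← Finset.insert_union]
      refine hgood _ _ (Finset.insert_subset ha (Finset.filter_subset _ _))
        (Finset.filter_subset _ _) ?_ ?_
      · rw [Finset.card_insert_of_notMem (by simp [hPa]), hc]
      · rcases hxy with ⟨h1, h2⟩ | h
        · left; simp [h1, h2]
        · right; simp [h]
    have hglue : ∀ a b : Pt, a ∈ X → b ∈ X → a ≠ b → cross x q a = 0 → cross x q b = 0 →
        (∀ z, z = x ∨ z = q ↔ z = a ∨ z = b) →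
        HasAvoidingMatching (insert a (X.filter fun z => 0 < cross x q z)) H →
        HasAvoidingMatching (insert b (X.filter fun z => cross x q z < 0)) H →
        HasAvoidingMatching X H := by
      intro a b ha hb hab ha0 hb0 hiff h1 h2
      convert h1.union h2 (convex_cross_pos_or_eq x q ha0) (convex_cross_neg_or_eq x q hb0)
        (by
          intro z hz
          simp only [Finset.coe_insert, Finset.coe_filter, mem_insert_iff, mem_ofPred_eq] at hz ⊢
          tauto)
        (by
          intro z hz
          simp only [Finset.coe_insert, Finset.coe_filter, mem_insert_iff, mem_ofPred_eq] at hz ⊢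
          tauto)
        (Set.disjoint_left.2 fun z hz hz' => by
          simp only [mem_ofPred_eq] at hz hz'
          rcases hz with hz | rfl <;> rcases hz' with hz' | rfl
          · linarith
          · linarith
          · linarith
          · exact hab rfl) using 1
      ext z
      simp only [Finset.mem_union, Finset.mem_filter, Finset.mem_insert]
      constructor
      · intro hz
        by_cases h : z = x ∨ z = q
        · have := (hiff z).1 h
          tauto
        · push Not at h
          rcases htri z hz h.1 h.2 with h | h <;> simp [hz, h]
      · rintro ((rfl | h) | (rfl | h))
        exacts [ha, h.1, hb, h.1]
    rcases htri y (hRX hy) hyx hyq with hypos | hyneg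
    · refine hglue q x hqX (hBX hx) hqx (by simp) (by simp) (fun z => or_comm)
        (hins q hqB _ (by simp) (by omega) (Or.inl ⟨hqx.symm, by simp⟩))
        (hins x hx _ (by simp) (by omega) (Or.inr hypos.not_gt))
    · refine hglue x q (hBX hx) hqX hqx.symm (by simp) (by simp) (fun z => Iff.rfl)
        (hins x hx _ (by simp) (by omega) (Or.inr hyneg.not_gt))
        (hins q hqB _ (by simp) (by omega) (Or.inl ⟨hqx.symm, by simp⟩))

namespace IsSplit

variable {n : ℕ} {X S S' : Finset Pt} {H : Finset (Sym2 Pt)} {x y : Pt}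

lemma mem_union_of_edge (h : IsSplit n X H S S' x y) {u v : Pt} (huv : s(u, v) ∈ H) :
    u ∈ S ∪ S' ∧ v ∈ S ∪ S' := by
  simp only [Finset.mem_union]
  by_cases he : s(u, v) = s(x, y)
  · have := h.mem_left
    have := h.mem_right
    rcases Sym2.eq_iff.1 he with ⟨rfl, rfl⟩ | ⟨rfl, rfl⟩ <;> tauto
  · have := h.edge_mem u v huv he
    tauto

lemma balanced (h : IsSplit n X H S S' x y) (hXcard : X.card = 2 * n) (hgp : GenPos X)
    (hno : ¬ HasAvoidingMatching X H) {V : Finset Pt} (hV : V ⊆ X \ (S ∪ S'))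
    (hVcard : V.card + S'.card = n) :
    ((S ∪ ((X \ (S ∪ S')) \ V)).filter fun z => 0 < cross x y z).card =
        ((S' ∪ V).filter fun z => 0 < cross x y z).card ∧
      ((S ∪ ((X \ (S ∪ S')) \ V)).filter fun z => cross x y z < 0).card =
        ((S' ∪ V).filter fun z => cross x y z < 0).card := by
  have hSS' : ∀ {z}, z ∈ S → z ∉ S' := fun h1 => Finset.disjoint_left.1 h.disjoint h1
  have hVmem : ∀ {z}, z ∈ V → z ∈ X ∧ z ∉ S ∧ z ∉ S' := fun h1 => by
    simpa using hV h1
  have hrest := h.card_rest hXcard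
  have hsum := h.card_add_card
  have hdiff := Finset.card_sdiff_add_card_eq_card hV
  refine balanced_sides hgp hno ?_ ?_ ?_ (Finset.mem_union_left _ h.mem_left)
    (Finset.mem_union_left _ h.mem_right) ?_
  · ext z
    have h1 := @h.left_subset z
    have h2 := @h.right_subset z
    have h3 := @hVmem z
    simp only [Finset.mem_union, Finset.mem_sdiff]
    tauto
  · refine Finset.disjoint_left.2 fun z h1 h2 => ?_
    have h3 := @hSS' z
    have h4 := @hVmem z
    simp only [Finset.mem_union, Finset.mem_sdiff] at h1 h2
    tauto
  · rw [Finset.card_union_of_disjoint, Finset.card_union_of_disjoint]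
    · omega
    · exact Finset.disjoint_right.2 fun z hz => (hVmem hz).2.2
    · refine Finset.disjoint_left.2 fun z h1 h2 => ?_
      simp [h1] at h2
  · intro b hb r hr hbr
    have hb' := @hVmem b
    have hr' := @hVmem r
    have hb'' := @hSS' b
    have hr'' := @hSS' r
    have hx := h.mem_left
    simp only [Finset.mem_union, Finset.mem_sdiff] at hb hr
    by_cases he : s(b, r) = s(x, y)
    · rcases Sym2.eq_iff.1 he with h1 | ⟨rfl, rfl⟩
      · exact h1
      · tauto
    · have := h.edge_mem b r hbr he
      tauto

lemma forall_pos_of_rest_pos (h : IsSplit n X H S S' x y) (hXcard : X.card = 2 * n)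
    (hgp : GenPos X) (hno : ¬ HasAvoidingMatching X H) (hxy : x ≠ y) (hS : 2 ≤ S.card)
    (hrest : ∀ w ∈ X \ (S ∪ S'), 0 < cross x y w) :
    ∀ z ∈ X, z ≠ x → z ≠ y → 0 < cross x y z := by
  have hSS' : ∀ {z}, z ∈ S → z ∉ S' := fun h1 => Finset.disjoint_left.1 h.disjoint h1
  have hWcard := h.card_rest hXcard
  have hsum := h.card_add_card
  have hWneg : ∀ V ⊆ X \ (S ∪ S'), V.filter (fun z => cross x y z < 0) = ∅ := fun V hV =>
    Finset.filter_eq_empty_iff.2 fun z hz => (hrest z (hV hz)).not_gt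
  have hm : (S.filter fun z => cross x y z < 0).card =
      (S'.filter fun z => cross x y z < 0).card := by
    obtain ⟨V, hV, hVcard⟩ := Finset.exists_subset_card_eq (s := X \ (S ∪ S'))
      (n := n - S'.card) (by have := Finset.card_pos.2 ⟨y, h.mem_right⟩; omega)
    have := (h.balanced hXcard hgp hno hV (by omega)).2
    rwa [Finset.filter_union, Finset.filter_union, hWneg _ hV, hWneg _ Finset.sdiff_subset,
      Finset.union_empty, Finset.union_empty] at this
  have hneg : S.filter (fun z => cross x y z < 0) = ∅ := by
    by_contra hne
    refine hno ?_
    have hpos := Finset.card_pos.2 (Finset.nonempty_iff_ne_empty.2 hne)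
    have h1 : HasAvoidingMatching ((S.filter fun z => cross x y z < 0) ∪
        S'.filter fun z => cross x y z < 0) H := by
      refine hasAvoidingMatching_of_bipartition (hgp.mono ?_)
        (Finset.disjoint_filter_filter h.disjoint) hm ?_
      · exact Finset.union_subset ((Finset.filter_subset _ _).trans h.left_subset)
          ((Finset.filter_subset _ _).trans h.right_subset)
      · intro r hr b hb hrb
        simp only [Finset.mem_filter] at hr hb
        by_cases he : s(r, b) = s(x, y)
        · rcases Sym2.eq_iff.1 he with ⟨rfl, rfl⟩ | ⟨rfl, rfl⟩ <;> simp at hr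
        · rcases h.edge_mem r b hrb he with h1 | h1
          · exact hSS' h1.2 hb.1
          · exact hSS' hr.1 h1.1
    rw [← Finset.filter_union] at h1
    have hTcard : ((S ∪ S').filter fun z => ¬ cross x y z < 0).card +
        2 * (S.filter fun z => cross x y z < 0).card = n + 1 := by
      have := Finset.card_filter_add_card_filter_not (s := S ∪ S') (fun z => cross x y z < 0)
      rw [Finset.card_union_of_disjoint h.disjoint, Finset.filter_union,
        Finset.card_union_of_disjoint (Finset.disjoint_filter_filter h.disjoint)] at this
      omega
    obtain ⟨V, hV, hVcard⟩ := Finset.exists_subset_card_eq (s := X \ (S ∪ S'))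
      (n := (S.filter fun z => cross x y z < 0).card - 1) (by omega)
    have hdiff := Finset.card_sdiff_add_card_eq_card hV
    have hVmem : ∀ {z}, z ∈ V → z ∈ X ∧ z ∉ S ∧ z ∉ S' := fun h1 => by
      simpa using hV h1
    have hX' : S ∪ S' ∪ X \ (S ∪ S') = X :=
      Finset.union_sdiff_of_subset (Finset.union_subset h.left_subset h.right_subset)
    have h2 : HasAvoidingMatching ((((S ∪ S').filter fun z => ¬ cross x y z < 0) ∪ V) ∪
        ((X \ (S ∪ S')) \ V)) H := by
      refine hasAvoidingMatching_of_bipartition (hgp.mono ?_) ?_ ?_ ?_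
      · refine Finset.union_subset (Finset.union_subset ((Finset.filter_subset _ _).trans
          (Finset.union_subset h.left_subset h.right_subset))
          (hV.trans Finset.sdiff_subset)) (Finset.sdiff_subset.trans Finset.sdiff_subset)
      · refine Finset.disjoint_left.2 fun z h1 h2 => ?_
        simp only [Finset.mem_union, Finset.mem_sdiff, Finset.mem_filter] at h1 h2
        tauto
      · rw [Finset.card_union_of_disjoint]
        · omega
        · refine Finset.disjoint_left.2 fun z h1 h2 => ?_
          have := hVmem h2
          simp only [Finset.mem_union, Finset.mem_filter] at h1
          tauto
      · intro r _ b hb hrb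
        have := (h.mem_union_of_edge hrb).2
        simp only [Finset.mem_sdiff] at hb
        tauto
    rw [Finset.union_assoc, Finset.union_sdiff_of_subset hV] at h2
    convert h1.union h2 (convex_cross_neg x y) (convex_cross_nonneg x y)
      (by intro z hz; simpa using (Finset.mem_filter.1 (Finset.mem_coe.1 hz)).2)
      (by
        intro z hz
        rcases Finset.mem_union.1 (Finset.mem_coe.1 hz) with hz | hz
        · simpa using (Finset.mem_filter.1 hz).2
        · exact (hrest z hz).le)
      (Set.disjoint_left.2 fun z hz hz' => by
        simp only [mem_ofPred_eq] at hz hz'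
        linarith) using 1
    rw [← Finset.union_assoc, Finset.filter_union_filter_not_eq, hX']
  have hneg' : S'.filter (fun z => cross x y z < 0) = ∅ := by
    rw [← Finset.card_eq_zero, ← hm, hneg, Finset.card_empty]
  intro z hz hzx hzy
  refine lt_of_le_of_ne (not_lt.1 fun hlt => ?_) (hgp.cross_ne_zero
    (h.left_subset h.mem_left) (h.right_subset h.mem_right) hz hxy hzx hzy).symm
  by_cases hzS : z ∈ S
  · exact Finset.filter_eq_empty_iff.1 hneg hzS hlt
  by_cases hzS' : z ∈ S'
  · exact Finset.filter_eq_empty_iff.1 hneg' hzS' hlt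
  exact (hrest z (by simp [hz, hzS, hzS'])).not_gt hlt

lemma rest_same_side (h : IsSplit n X H S S' x y) (hXcard : X.card = 2 * n) (hgp : GenPos X)
    (hno : ¬ HasAvoidingMatching X H) (hS : 2 ≤ S.card) (hS' : 2 ≤ S'.card) {w w' : Pt}
    (hw : w ∈ X \ (S ∪ S')) (hw' : w' ∈ X \ (S ∪ S')) (hpos : 0 < cross x y w) :
    ¬ cross x y w' < 0 := by
  intro hneg
  have hww' : w ≠ w' := by rintro rfl; linarith
  have hWcard := h.card_rest hXcard
  have hsum := h.card_add_card
  set W := X \ (S ∪ S') with hW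
  have hWdef : ∀ {z}, z ∈ W → z ∉ S ∧ z ∉ S' := fun h1 => by
    simp only [hW, Finset.mem_sdiff, Finset.mem_union] at h1
    tauto
  have hcard2 : ((W.erase w).erase w').card + 2 = W.card := by
    have h1 := Finset.card_erase_add_one hw
    have h2 := Finset.card_erase_add_one (Finset.mem_erase.2 ⟨hww'.symm, hw'⟩)
    omega
  obtain ⟨V, hV, hVcard⟩ := Finset.exists_subset_card_eq (s := (W.erase w).erase w')
    (n := n - S'.card - 1) (by omega)
  have hVW : ∀ {z}, z ∈ V → z ≠ w' ∧ z ≠ w ∧ z ∈ W := fun h1 => by simpa using hV h1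
  have hwV : w ∉ V := fun h1 => (hVW h1).2.1 rfl
  have hw'V : w' ∉ V := fun h1 => (hVW h1).1 rfl
  have key : ∀ v ∈ W, v ∉ V → ((S ∪ (W \ insert v V)).filter fun z => 0 < cross x y z).card =
      ((S' ∪ insert v V).filter fun z => 0 < cross x y z).card := fun v hv hvV =>
    (h.balanced hXcard hgp hno (V := insert v V)
      (Finset.insert_subset hv fun z hz => (hVW hz).2.2)
      (by rw [Finset.card_insert_of_notMem hvV]; omega)).1
  have hdisj : ∀ V' ⊆ W, Disjoint S V' ∧ Disjoint S' V' := fun V' hV' =>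
    ⟨Finset.disjoint_right.2 fun z hz => (hWdef (hV' hz)).1,
      Finset.disjoint_right.2 fun z hz => (hWdef (hV' hz)).2⟩
  have hsplit : ∀ v ∈ W, v ∉ V → (S.filter fun z => 0 < cross x y z).card +
      (W.filter fun z => 0 < cross x y z).card = (S'.filter fun z => 0 < cross x y z).card +
      2 * ((insert v V).filter fun z => 0 < cross x y z).card := by
    intro v hv hvV
    have h1 := key v hv hvV
    have hsub : insert v V ⊆ W := Finset.insert_subset hv fun z hz => (hVW hz).2.2
    rw [Finset.filter_union, Finset.filter_union,
      Finset.card_union_of_disjoint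
        (Finset.disjoint_filter_filter (hdisj _ Finset.sdiff_subset).1),
      Finset.card_union_of_disjoint (Finset.disjoint_filter_filter (hdisj _ hsub).2)] at h1
    have h2 : ((W \ insert v V).filter fun z => 0 < cross x y z).card +
        ((insert v V).filter fun z => 0 < cross x y z).card =
        (W.filter fun z => 0 < cross x y z).card := by
      rw [← Finset.card_union_of_disjoint
        (Finset.disjoint_filter_filter Finset.sdiff_disjoint), ← Finset.filter_union,
        Finset.sdiff_union_of_subset hsub]
    omega
  have h1 := hsplit w hw hwV
  have h2 := hsplit w' hw' hw'V
  rw [Finset.filter_insert, if_pos hpos, Finset.card_insert_of_notMem (by simp [hwV])] at h1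
  rw [Finset.filter_insert, if_neg hneg.not_gt] at h2
  omega

lemma forall_pos_or_forall_neg (h : IsSplit n X H S S' x y) (hXcard : X.card = 2 * n)
    (hgp : GenPos X) (hno : ¬ HasAvoidingMatching X H) (hxy : x ≠ y) (hS : 2 ≤ S.card)
    (hS' : 2 ≤ S'.card) :
    (∀ z ∈ X, z ≠ x → z ≠ y → 0 < cross x y z) ∨
      ∀ z ∈ X, z ≠ x → z ≠ y → 0 < cross y x z := by
  by_cases hw : ∃ w ∈ X \ (S ∪ S'), 0 < cross x y w
  · obtain ⟨w, hw, hpos⟩ := hw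
    left
    refine h.forall_pos_of_rest_pos hXcard hgp hno hxy hS fun w' hw' => ?_
    have hmem : w' ∈ X ∧ w' ∉ S ∧ w' ∉ S' := by simpa using hw'
    refine lt_of_le_of_ne (not_lt.1 (h.rest_same_side hXcard hgp hno hS hS' hw hw' hpos))
      (hgp.cross_ne_zero (h.left_subset h.mem_left) (h.right_subset h.mem_right) hmem.1 hxy
        ?_ ?_).symm
    · rintro rfl; exact hmem.2.1 h.mem_left
    · rintro rfl; exact hmem.2.2 h.mem_right
  · push Not at hw
    right
    have := h.symm.forall_pos_of_rest_pos hXcard hgp hno hxy.symm hS' fun w' hw' => ?_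
    · exact fun z hz h1 h2 => this z hz h2 h1
    rw [Finset.union_comm] at hw'
    have hmem : w' ∈ X ∧ w' ∉ S ∧ w' ∉ S' := by simpa using hw'
    rw [cross_swap, neg_pos]
    refine lt_of_le_of_ne (hw w' hw') (hgp.cross_ne_zero (h.left_subset h.mem_left)
      (h.right_subset h.mem_right) hmem.1 hxy ?_ ?_)
    · rintro rfl; exact hmem.2.1 h.mem_left
    · rintro rfl; exact hmem.2.2 h.mem_right

end IsSplit

lemma mem_extremePoints_of_notMem_convexHull_erase {X : Finset Pt} {p : Pt} (hp : p ∈ X)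
    (h : p ∉ convexHull ℝ ((X.erase p : Finset Pt) : Set Pt)) :
    p ∈ (convexHull ℝ (X : Set Pt)).extremePoints ℝ := by
  by_contra hext
  have hsub : (convexHull ℝ (X : Set Pt)).extremePoints ℝ ⊆ ((X.erase p : Finset Pt) : Set Pt) := by
    intro z hz
    have hzX := extremePoints_convexHull_subset hz
    rw [Finset.coe_erase]
    exact ⟨hzX, fun hzp => hext (hzp ▸ hz)⟩
  have hcl := closure_convexHull_extremePoints (X.finite_toSet.isCompact_convexHull ℝ)
    (convex_convexHull ℝ (X : Set Pt))
  have hmem : p ∈ convexHull ℝ (X : Set Pt) := subset_convexHull ℝ _ hp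
  rw [← hcl] at hmem
  have := closure_mono (convexHull_mono hsub) hmem
  rw [((X.erase p).finite_toSet.isClosed_convexHull ℝ).closure_eq] at this
  exact h this

lemma notMem_convexHull_erase_of_forall_pos {X : Finset Pt} {x y : Pt} (hxy : x ≠ y)
    (h : ∀ z ∈ X, z ≠ x → z ≠ y → 0 < cross x y z) :
    x ∉ convexHull ℝ ((X.erase x : Finset Pt) : Set Pt) ∧
      y ∉ convexHull ℝ ((X.erase y : Finset Pt) : Set Pt) := by
  constructor
  · intro hx
    have := convexHull_min (fun z hz => ?_)
      (convex_cross_pos_or_eq x y (cross_right x y)) hx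
    · simp [hxy] at this
    · have hz' := Finset.mem_erase.1 (Finset.mem_coe.1 hz)
      exact or_iff_not_imp_right.2 fun hzy => h z hz'.2 hz'.1 hzy
  · intro hy
    have := convexHull_min (fun z hz => ?_)
      (convex_cross_pos_or_eq x y (cross_left x y)) hy
    · simp [hxy.symm] at this
    · have hz' := Finset.mem_erase.1 (Finset.mem_coe.1 hz)
      exact or_iff_not_imp_right.2 fun hzx => h z hz'.2 hzx hz'.1

lemma hasAvoidingMatching_of_even {Y : Finset Pt} {H : Finset (Sym2 Pt)} (hgp : GenPos Y)
    (heven : Even Y.card) (hH : ∀ u ∈ Y, ∀ v ∈ Y, s(u, v) ∉ H) : HasAvoidingMatching Y H := by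
  obtain ⟨k, hk⟩ := heven
  obtain ⟨R, hR, hRcard⟩ := Finset.exists_subset_card_eq (s := Y) (n := k) (by omega)
  have hdiff := Finset.card_sdiff_add_card_eq_card hR
  rw [← Finset.union_sdiff_of_subset hR] at hgp ⊢
  exact hasAvoidingMatching_of_bipartition hgp Finset.disjoint_sdiff (by omega)
    fun r hr b hb => hH r (hR hr) b (Finset.sdiff_subset hb)

/-- If `p` is not a hull vertex, then among the segments crossing the line `pw` there is one lying
on the hull of `X`, oriented so that all other points are to its left. -/
lemma exists_hull_edge_across {X : Finset Pt} (hgp : GenPos X) {p w : Pt} (hp : p ∈ X)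
    (hpw : p ≠ w) (hw : w ∈ X) (hpos : ∃ u ∈ X, 0 < cross p w u) (hneg : ∃ v ∈ X, cross p w v < 0)
    (hhull : p ∈ convexHull ℝ ((X.erase p : Finset Pt) : Set Pt)) :
    ∃ u ∈ X, ∃ v ∈ X, 0 < cross p w u ∧ cross p w v < 0 ∧
      ∀ z ∈ X, z ≠ u → z ≠ v → 0 < cross u v z := by
  obtain ⟨u₀, hu₀, hu₀'⟩ := hpos
  obtain ⟨v₀, hv₀, hv₀'⟩ := hneg
  obtain ⟨⟨u, v⟩, huv, hmax⟩ := Finset.exists_max_image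
    ((X.filter fun z => 0 < cross p w z) ×ˢ (X.filter fun z => cross p w z < 0))
    (fun t => cross p t.1 t.2 / (cross p w t.1 - cross p w t.2)) ⟨(u₀, v₀), by simp [*]⟩
  simp only [Finset.mem_product, Finset.mem_filter] at huv hmax
  obtain ⟨⟨hu, hu'⟩, hv, hv'⟩ := huv
  have huv : u ≠ v := by rintro rfl; linarith
  have hleft : ∀ z ∈ X, 0 < cross p w z → 0 ≤ cross u v z := by
    intro z hz hz'
    have h1 := hmax (z, v) ⟨⟨hz, hz'⟩, hv, hv'⟩
    rw [div_le_div_iff₀ (by linarith) (by linarith)] at h1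
    have h2 : cross p z v * (cross p w u - cross p w v) -
        cross p u v * (cross p w z - cross p w v) = cross p w v * cross u v z := by
      simp only [cross]; ring
    by_contra h
    nlinarith [mul_pos_of_neg_of_neg hv' (not_le.1 h)]
  have hright : ∀ z ∈ X, cross p w z < 0 → 0 ≤ cross u v z := by
    intro z hz hz'
    have h1 := hmax (u, z) ⟨⟨hu, hu'⟩, hz, hz'⟩
    rw [div_le_div_iff₀ (by linarith) (by linarith)] at h1
    have h2 : cross p u z * (cross p w u - cross p w v) -
        cross p u v * (cross p w u - cross p w z) = -(cross p w u * cross u v z) := by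
      simp only [cross]; ring
    by_contra h
    nlinarith [mul_neg_of_pos_of_neg hu' (not_le.1 h)]
  have hwp : cross u v w - cross u v p = cross p w u - cross p w v := by
    simp only [cross]; ring
  have hoff : ∀ z ∈ X, z ≠ p → z ≠ w → 0 ≤ cross u v z := fun z hz h1 h2 => by
    rcases (hgp.cross_ne_zero hp hw hz hpw h1 h2).lt_or_gt with h | h
    exacts [hright z hz h, hleft z hz h]
  have hpuv : 0 ≤ cross u v p := by
    by_contra h
    have := convexHull_min (fun z hz => ?_) (convex_lt_cross u v (cross u v p)) hhull
    · simp at this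
    · have hz' := Finset.mem_erase.1 (Finset.mem_coe.1 hz)
      simp only [mem_ofPred_eq]
      by_cases hzw : z = w
      · subst hzw; linarith
      · linarith [hoff z hz'.2 hz'.1 hzw]
  refine ⟨u, hu, v, hv, hu', hv', fun z hz hzu hzv => lt_of_le_of_ne ?_
    (hgp.cross_ne_zero hu hv hz huv hzu hzv).symm⟩
  by_cases hzp : z = p
  · rwa [hzp]
  by_cases hzw : z = w
  · subst hzw; linarith
  exact hoff z hz hzp hzw

lemma hasAvoidingMatching_of_star {n : ℕ} {X : Finset Pt} (hXcard : X.card = 2 * n)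
    (hgp : GenPos X) {H : Finset (Sym2 Pt)} (hHcard : H.card = n) (hn : 2 ≤ n) {p : Pt}
    (hp : p ∈ X) (hstar : ∀ e ∈ H, p ∈ e)
    (hhull : p ∈ convexHull ℝ ((X.erase p : Finset Pt) : Set Pt)) : HasAvoidingMatching X H := by
  obtain ⟨w, hw, hwH⟩ : ∃ w ∈ X.erase p, s(p, w) ∉ H := by
    by_contra! h
    have := Finset.card_le_card_of_injOn (fun z => s(p, z)) h
      (fun a _ b _ hab => Sym2.congr_right.1 hab)
    rw [Finset.card_erase_of_mem hp] at this
    omega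
  obtain ⟨hwp, hwX⟩ := Finset.mem_erase.1 hw
  have hnotH : ∀ {u v : Pt}, u ≠ p → v ≠ p → s(u, v) ∉ H := fun hu hv h => by
    rcases Sym2.mem_iff.1 (hstar _ h) with h | h
    exacts [hu h.symm, hv h.symm]
  have htri : ∀ z ∈ X, z = p ∨ z = w ∨ 0 < cross p w z ∨ cross p w z < 0 := fun z hz => by
    by_cases h1 : z = p
    · exact Or.inl h1
    by_cases h2 : z = w
    · exact Or.inr (Or.inl h2)
    exact Or.inr (Or.inr (hgp.cross_ne_zero hp hwX hz hwp.symm h1 h2).lt_or_gt.symm)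
  have hunion : (X.filter fun z => 0 < cross p w z) ∪ {p, w} ∪
      (X.filter fun z => cross p w z < 0) = X := by
    ext z
    have := htri z
    simp only [Finset.mem_union, Finset.mem_filter, Finset.mem_insert, Finset.mem_singleton]
    constructor
    · rintro ((h | rfl | rfl) | h)
      exacts [h.1, hp, hwX, h.1]
    · tauto
  have hcard : (X.filter fun z => 0 < cross p w z).card +
      (X.filter fun z => cross p w z < 0).card + 2 = 2 * n := by
    rw [← hXcard]
    conv_rhs => rw [← hunion]
    rw [Finset.card_union_of_disjoint, Finset.card_union_of_disjoint, Finset.card_pair hwp.symm]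
    · ring
    · refine Finset.disjoint_left.2 fun z h1 h2 => ?_
      simp only [Finset.mem_filter, Finset.mem_insert, Finset.mem_singleton] at h1 h2
      rcases h2 with rfl | rfl <;> simp at h1
    · refine Finset.disjoint_left.2 fun z h1 h2 => ?_
      simp only [Finset.mem_union, Finset.mem_filter, Finset.mem_insert,
        Finset.mem_singleton] at h1 h2
      rcases h1 with h1 | rfl | rfl
      · linarith
      · simp at h2
      · simp at h2
  have hside : ∀ Y ⊆ X, p ∉ Y → Even Y.card → HasAvoidingMatching Y H := fun Y hY hpY hYeven =>
    hasAvoidingMatching_of_even (hgp.mono hY) hYeven fun u hu v hv =>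
      hnotH (ne_of_mem_of_not_mem hu hpY) (ne_of_mem_of_not_mem hv hpY)
  by_cases heven : Even (X.filter fun z => 0 < cross p w z).card
  · have heven' : Even (X.filter fun z => cross p w z < 0).card := by
      rw [Nat.even_iff] at heven ⊢
      omega
    rw [← hunion]
    exact (hside _ (Finset.filter_subset _ _) (by simp) heven).union_line
      (hside _ (Finset.filter_subset _ _) (by simp) heven') hwp.symm hwH
      (fun z hz => (Finset.mem_filter.1 hz).2) (fun z hz => (Finset.mem_filter.1 hz).2)
  have hodd' : ¬ Even (X.filter fun z => cross p w z < 0).card := by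
    rw [Nat.even_iff] at heven ⊢
    omega
  have hex : ∀ (P : Pt → Prop) [DecidablePred P], ¬ Even (X.filter P).card → ∃ z ∈ X, P z := by
    intro P _ h
    by_contra! hP
    rw [Finset.filter_eq_empty_iff.2 fun z hz => hP z hz] at h
    simp at h
  obtain ⟨u, hu, v, hv, hu', hv', huv⟩ :=
    exists_hull_edge_across hgp hp hwp.symm hwX (hex _ heven) (hex _ hodd') hhull
  have hup : u ≠ p := by rintro rfl; simp at hu'
  have hvp : v ≠ p := by rintro rfl; simp at hv'
  have huw : u ≠ w := by rintro rfl; simp at hu'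
  have hvw : v ≠ w := by rintro rfl; simp at hv'
  have huv' : u ≠ v := by rintro rfl; linarith
  have herase : ∀ (P : Pt → Prop) [DecidablePred P] (a : Pt), a ∈ X → P a → ¬ P p →
      ¬ Even (X.filter P).card → HasAvoidingMatching ((X.filter P).erase a) H := by
    intro P _ a ha hPa hPp h
    refine hside _ ((Finset.erase_subset _ _).trans (Finset.filter_subset _ _)) (by simp [hPp]) ?_
    have := Finset.card_erase_add_one (Finset.mem_filter.2 ⟨ha, hPa⟩)
    rw [Nat.even_iff] at h ⊢
    omega
  have hmid := (herase _ u hu hu' (by simp) heven).union_line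
    (herase _ v hv hv' (by simp) hodd') hwp.symm hwH
    (fun z hz => (Finset.mem_filter.1 (Finset.mem_of_mem_erase hz)).2)
    (fun z hz => (Finset.mem_filter.1 (Finset.mem_of_mem_erase hz)).2)
  have hset : (X.filter fun z => 0 < cross p w z).erase u ∪ {p, w} ∪
      (X.filter fun z => cross p w z < 0).erase v = X \ {u, v} := by
    ext z
    simp only [Finset.mem_union, Finset.mem_filter, Finset.mem_insert, Finset.mem_singleton,
      Finset.mem_erase, Finset.mem_sdiff]
    constructor
    · rintro ((⟨h1, h2, h3⟩ | rfl | rfl) | ⟨h1, h2, h3⟩)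
      · refine ⟨h2, ?_⟩
        rintro (rfl | rfl)
        exacts [h1 rfl, h3.not_gt hv']
      · exact ⟨hp, by simp [hup.symm, hvp.symm]⟩
      · exact ⟨hwX, by simp [huw.symm, hvw.symm]⟩
      · refine ⟨h2, ?_⟩
        rintro (rfl | rfl)
        exacts [h3.not_gt hu', h1 rfl]
    · have := htri z
      tauto
  rw [hset] at hmid
  have hpair : ∀ z ∈ ({u, v} : Finset Pt), cross u v z = 0 := by simp
  have := hmid.union (hasAvoidingMatching_pair huv' (hnotH hup hvp)) (convex_cross_pos u v)
    (convex_cross_eq_zero u v) (fun z hz => ?_) hpair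
    (Set.disjoint_left.2 fun z (hz : 0 < _) (hz' : _ = 0) => hz.ne' hz')
  · rwa [Finset.sdiff_union_of_subset] at this
    simp [Finset.insert_subset_iff, hu, hv]
  · have hz' : z ∈ X ∧ ¬ (z = u ∨ z = v) := by simpa using hz
    rw [not_or] at hz'
    exact huv z hz'.1 hz'.2.1 hz'.2.2

/-- If `p` has degree at least two in `H` and all its neighbours are leaves, then `H` is a star. -/
lemma mem_of_mem_of_leaves {n : ℕ} {X : Finset Pt} (hXcard : X.card = 2 * n) (hgp : GenPos X)
    {H : Finset (Sym2 Pt)} (hH : ∀ e ∈ H, IsEdgeOf X e) (hHcard : H.card = n)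
    (hno : ¬ HasAvoidingMatching X H) {p : Pt} {e f : Sym2 Pt} (he : e ∈ H) (hf : f ∈ H)
    (hef : e ≠ f) (hpe : p ∈ e) (hpf : p ∈ f)
    (hleaf : ∀ r, s(p, r) ∈ H → ∀ g ∈ H, r ∈ g → g = s(p, r)) : ∀ g ∈ H, p ∈ g := by
  obtain ⟨q₁, rfl⟩ := Sym2.mem_iff_exists.1 hpe
  obtain ⟨q₂, rfl⟩ := Sym2.mem_iff_exists.1 hpf
  have hedge : ∀ {u v : Pt}, s(u, v) ∈ H → u ≠ v ∧ u ∈ X ∧ v ∈ X := fun {u v} h =>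
    ⟨by simpa using (hH _ h).1, (hH _ h).2 u (by simp), (hH _ h).2 v (by simp)⟩
  set N := X.filter fun z => s(p, z) ∈ H
  have hN : ∀ {z}, z ∈ N ↔ s(p, z) ∈ H := fun {z} => by
    simpa [N] using fun h => (hedge h).2.2
  have hNcard : N.card ≤ (H.filter (p ∈ ·)).card :=
    Finset.card_le_card_of_injOn (fun z => s(p, z)) (fun z hz => by simp [hN.1 hz])
      fun a _ b _ hab => Sym2.congr_right.1 hab
  have hpX := (hedge he).2.1
  set A := insert p N with hA
  have hAX : A ⊆ X := Finset.insert_subset hpX (Finset.filter_subset _ _)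
  have hAcard : A.card ≤ N.card + 1 := Finset.card_insert_le p N
  have hsum := Finset.card_filter_add_card_filter_not (s := H) (p ∈ ·)
  have hdiff := Finset.card_sdiff_add_card_eq_card hAX
  obtain ⟨l₀, hl₀, hl₀card⟩ := exists_labelling (X \ A) (H.filter (p ∉ ·))
  set l : Pt → Option Pt := fun z => if z ∈ A then none else some (l₀ z) with hl
  have hlnone : ∀ z, l z = none ↔ z ∈ A := fun z => by simp [hl]
  have hAclosed : ∀ u v, s(u, v) ∈ H → u ∈ A → v ∈ A := by
    intro u v huv hu
    rcases Finset.mem_insert.1 hu with rfl | hu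
    · exact Finset.mem_insert_of_mem (hN.2 huv)
    · have h1 : p ∈ s(u, v) := by simp [hleaf u (hN.1 hu) _ huv (by simp)]
      rcases Sym2.mem_iff.1 h1 with rfl | rfl
      · exact ((hedge (hN.1 hu)).1 rfl).elim
      · exact Finset.mem_insert_self _ _
  have hlH : ∀ u v, s(u, v) ∈ H → l u = l v := by
    intro u v huv
    have hiff : u ∈ A ↔ v ∈ A :=
      ⟨hAclosed u v huv, hAclosed v u (by rwa [Sym2.eq_swap])⟩
    by_cases hu : u ∈ A
    · simp [hl, hu, hiff.1 hu]
    · have hv : v ∉ A := fun h => hu (hiff.2 h)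
      have hpuv : p ∉ s(u, v) := by
        rw [Sym2.mem_iff]
        rintro (rfl | rfl)
        exacts [hu (Finset.mem_insert_self _ _), hv (Finset.mem_insert_self _ _)]
      simp [hl, hu, hv, hl₀ u v (Finset.mem_filter.2 ⟨huv, hpuv⟩)]
  have hlcard : ((X \ A).image l₀).card + 1 ≤ (X.image l).card := by
    rw [← Finset.card_map Function.Embedding.some, ← Finset.card_insert_of_notMem (a := none)
      (by simp)]
    refine Finset.card_le_card (Finset.insert_subset
      (Finset.mem_image.2 ⟨p, hpX, by simp [hl, hA]⟩) fun o ho => ?_)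
    obtain ⟨c, hc, rfl⟩ := Finset.mem_map.1 ho
    obtain ⟨z, hz, rfl⟩ := Finset.mem_image.1 hc
    rw [Finset.mem_sdiff] at hz
    exact Finset.mem_image.2 ⟨z, hz.1, by simp [hl, hz.2]⟩
  have hclass : X.filter (l · = none) = A := by
    ext z
    simpa [hlnone] using fun h => hAX h
  obtain ⟨hpq₁, -, hq₁⟩ := hedge he
  obtain ⟨hpq₂, -, hq₂⟩ := hedge hf
  have hAthree : 3 ≤ A.card := Finset.two_lt_card.2
    ⟨p, by simp [hA], q₁, by simp [hA, hN, he], q₂, by simp [hA, hN, hf], hpq₁, hpq₂,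
      fun h => hef (h ▸ rfl)⟩
  have hbig := ((label_classes hXcard hgp hno l hlH (by omega)).2 none
    (Finset.mem_image.2 ⟨p, hpX, by simp [hl, hA]⟩) (by rwa [hclass])).1
  rw [hclass] at hbig
  have hempty : (H.filter (p ∉ ·)).card = 0 := by omega
  intro g hg
  by_contra hpg
  exact Finset.filter_eq_empty_iff.1 (Finset.card_eq_zero.1 hempty) hg hpg

/-- Lemma, part (b): if removing a set `H` of exactly `n` edges eliminates all
non-crossing perfect matchings, then every point that is an endpoint of at least two edges of `H`
is an extreme point of the convex hull of `X`. -/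
theorem high_degree_vertex_on_hull (n : ℕ) (X : Finset Pt)
    (hXcard : X.card = 2 * n) (hgp : GenPos X)
    (H : Finset (Sym2 Pt)) (hH : ∀ e ∈ H, IsEdgeOf X e) (hHcard : H.card = n)
    (helim : ∀ M : Finset (Sym2 Pt), IsNCMatching X M → ¬ Avoids M H)
    (p : Pt) (hp : p ∈ X)
    (hdeg : ∃ e ∈ H, ∃ f ∈ H, e ≠ f ∧ p ∈ e ∧ p ∈ f) :
    p ∈ Set.extremePoints ℝ (convexHull ℝ (X : Set Pt)) := by
  have hno : ¬ HasAvoidingMatching X H := fun ⟨M, hM, hMH⟩ => helim M hM hMH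
  refine mem_extremePoints_of_notMem_convexHull_erase hp fun hhull => ?_
  obtain ⟨e, he, f, hf, hef, hpe, hpf⟩ := hdeg
  by_cases hr : ∃ r, s(p, r) ∈ H ∧ ∃ g ∈ H, g ≠ s(p, r) ∧ r ∈ g
  · obtain ⟨r, hpr, g, hg, hgpr, hrg⟩ := hr
    obtain ⟨q₁, rfl⟩ := Sym2.mem_iff_exists.1 hpe
    obtain ⟨q₂, rfl⟩ := Sym2.mem_iff_exists.1 hpf
    have hprne : p ≠ r := by simpa using (hH _ hpr).1
    obtain ⟨S, S', hsplit⟩ := exists_isSplit hXcard hgp hH hHcard hno he hf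
      (fun h => hef (h ▸ rfl)) hpr
    have hS : 2 ≤ S.card := by
      by_cases h : s(p, q₁) = s(p, r)
      · exact hsplit.two_le_card_left hf (h ▸ hef.symm) (hH _ hf).1 hpf
      · exact hsplit.two_le_card_left he h (hH _ he).1 hpe
    have hS' : 2 ≤ S'.card :=
      hsplit.symm.two_le_card_left hg (by rwa [Sym2.eq_swap]) (hH _ hg).1 hrg
    rcases hsplit.forall_pos_or_forall_neg hXcard hgp hno hprne hS hS' with h | h
    · exact (notMem_convexHull_erase_of_forall_pos hprne h).1 hhull
    · exact (notMem_convexHull_erase_of_forall_pos hprne.symm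
        fun z hz h1 h2 => h z hz h2 h1).2 hhull
  · have hleaf : ∀ r, s(p, r) ∈ H → ∀ g ∈ H, r ∈ g → g = s(p, r) := by
      push Not at hr
      intro r hpr g hg hrg
      by_contra hne
      exact hr r hpr g hg hne hrg
    have hn : 2 ≤ n := hHcard ▸ Finset.one_lt_card.2 ⟨e, he, f, hf, hef⟩
    exact hno (hasAvoidingMatching_of_star hXcard hgp hHcard hn hp
      (mem_of_mem_of_leaves hXcard hgp hH hHcard hno he hf hef hpe hpf hleaf) hhull)
end
end
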